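/- arXiv:2509.04726 — 3 statements merged into one kernel-verified Lean document; each statement's English description precedes it below -/
import Mathlib

section
/- Let P ⊆ ℝ^d be a rational polytope. Then the function n ↦ aw(nP) is eventually quasilinear in the integer dilation parameter n: there exist a positive integer D (one may take D = denom(P)), an integer N, and rational numbers a_0, …, a_{D−1}, b_0, …, b_{D−1} such that for every integer n ≥ N, aw(nP) = a_r·n + b_r, where r = n mod D. -/
open Pointwise

/-- The set of integer points of `K ⊆ ℝ^d`, as integer vectors. -/
def intPts {d : ℕ} (K : Set (Fin d → ℝ)) : Set (Fin d → ℤ) :=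
  {x | (fun i => (x i : ℝ)) ∈ K}

/-- The arithmetic range of `K` in direction `c`. -/
def AR {d : ℕ} (c : Fin d → ℤ) (K : Set (Fin d → ℝ)) : Set ℤ :=
  {n | ∃ x ∈ intPts K, n = ∑ i, c i * x i}

/-- The arithmetic width of `K` in direction `c`. -/
noncomputable def aw {d : ℕ} (c : Fin d → ℤ) (K : Set (Fin d → ℝ)) : ℕ :=
  (AR c K).ncard

/-- The arithmetic width of `K`: the minimum of `aw_c(K)` over nonzero `c ∈ ℤ^d`. -/
noncomputable def awMin {d : ℕ} (K : Set (Fin d → ℝ)) : ℕ :=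
  sInf {m : ℕ | ∃ c : Fin d → ℤ, c ≠ 0 ∧ m = aw c K}

/-- `P ⊆ ℝ^d` is a rational polytope: the convex hull of finitely many rational points. -/
def IsRatPolytope {d : ℕ} (P : Set (Fin d → ℝ)) : Prop :=
  ∃ V : Finset (Fin d → ℚ), V.Nonempty ∧
    P = convexHull ℝ ((fun v : Fin d → ℚ => (fun i => ((v i : ℚ) : ℝ))) '' (V : Set (Fin d → ℚ)))

open Filter in
/-- Eventually linear functions. -/
def EL (f : ℕ → ℕ) : Prop := ∃ a b : ℚ, ∀ᶠ k : ℕ in atTop, (f k : ℚ) = a * k + b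

open Filter in
lemma EL.sum {ι : Type*} (s : Finset ι) (f : ι → ℕ → ℕ) (h : ∀ i ∈ s, EL (f i)) :
    EL (fun k => ∑ i ∈ s, f i k) := by
  classical
  induction s using Finset.induction_on with
  | empty => exact ⟨0, 0, by simp⟩
  | insert i s hi ih =>
    obtain ⟨a, b, hab⟩ := ih (fun j hj => h j (Finset.mem_insert_of_mem hj))
    obtain ⟨a', b', hab'⟩ := h i (Finset.mem_insert_self _ _)
    refine ⟨a' + a, b' + b, ?_⟩
    filter_upwards [hab, hab'] with k h1 h2
    rw [Finset.sum_insert hi]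
    push_cast at h1 ⊢
    rw [h1, h2]; ring

open Filter in
lemma eventually_lin (a b : ℚ) (ha : 0 < a) : ∀ᶠ k : ℕ in atTop, b ≤ a * k := by
  have := (tendsto_natCast_atTop_atTop (R := ℚ)).eventually_ge_atTop (b / a)
  filter_upwards [this] with k hk
  rw [div_le_iff₀ ha] at hk
  linarith

open Filter in
lemma EL.total {f g : ℕ → ℕ} (hf : EL f) (hg : EL g) :
    (∀ᶠ k in atTop, f k ≤ g k) ∨ (∀ᶠ k in atTop, g k ≤ f k) := by
  obtain ⟨a, b, h⟩ := hf
  obtain ⟨a', b', h'⟩ := hg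
  rcases lt_trichotomy a a' with hlt | heq | hlt
  · left
    filter_upwards [h, h', eventually_lin (a' - a) (b - b') (by linarith)] with k h1 h2 h3
    have : (f k : ℚ) ≤ g k := by rw [h1, h2]; linarith
    exact_mod_cast this
  · subst heq
    rcases le_total b b' with hb | hb
    · left
      filter_upwards [h, h'] with k h1 h2
      have : (f k : ℚ) ≤ g k := by rw [h1, h2]; linarith
      exact_mod_cast this
    · right
      filter_upwards [h, h'] with k h1 h2
      have : (g k : ℚ) ≤ f k := by rw [h1, h2]; linarith
      exact_mod_cast this
  · right
    filter_upwards [h, h', eventually_lin (a - a') (b' - b) (by linarith)] with k h1 h2 h3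
    have : (g k : ℚ) ≤ f k := by rw [h1, h2]; linarith
    exact_mod_cast this

open Filter in
lemma EL.exists_min {ι : Type*} (s : Finset ι) (hs : s.Nonempty) (f : ι → ℕ → ℕ)
    (h : ∀ i, EL (f i)) : ∃ i ∈ s, ∀ᶠ k in atTop, ∀ j ∈ s, f i k ≤ f j k := by
  classical
  induction hs using Finset.Nonempty.cons_induction with
  | singleton a => exact ⟨a, by simp, by simp⟩
  | cons a s ha hs ih =>
    obtain ⟨i, hi, hmin⟩ := ih
    rcases (h i).total (h a) with h1 | h1
    · refine ⟨i, by simp [hi], ?_⟩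
      filter_upwards [hmin, h1] with k h2 h3 j hj
      rcases Finset.mem_cons.1 hj with rfl | hj
      · exact h3
      · exact h2 j hj
    · refine ⟨a, by simp, ?_⟩
      filter_upwards [hmin, h1] with k h2 h3 j hj
      rcases Finset.mem_cons.1 hj with rfl | hj
      · exact le_rfl
      · exact h3.trans (h2 j hj)

/-- an integer sequence eventually nondecreasing and bounded above is eventually constant -/
lemma eventually_const_of_mono (g : ℕ → ℤ) (C : ℤ) (k0 : ℕ) (hm : ∀ k ≥ k0, g k ≤ g (k + 1))
    (hb : ∀ k ≥ k0, g k ≤ C) : ∃ N, ∃ b : ℤ, ∀ k ≥ N, g k = b := by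
  classical
  have hmono : ∀ k ≥ k0, ∀ l ≥ k, g k ≤ g l := by
    intro k hk l hl
    induction l, hl using Nat.le_induction with
    | base => exact le_rfl
    | succ l hl ih => exact ih.trans (hm l (by omega))
  have hex : ∃ m : ℕ, ∃ k ≥ k0, (C - g k).toNat = m := ⟨_, k0, le_rfl, rfl⟩
  obtain ⟨k1, hk1, he⟩ := Nat.find_spec hex
  refine ⟨k1, g k1, fun k hk => ?_⟩
  have h1 := Nat.find_min' hex ⟨k, by omega, rfl⟩
  rw [← he] at h1
  have := hmono k1 hk1 k hk
  have := hb k (by omega)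
  have := hb k1 hk1
  omega

open Filter in
lemma EL.of_mono (f : ℕ → ℕ) (q : ℕ) (C : ℤ) (k0 : ℕ) (hm : ∀ k ≥ k0, f k + q ≤ f (k + 1))
    (hb : ∀ k ≥ k0, (f k : ℤ) ≤ q * k + C) : EL f := by
  obtain ⟨N, b, h⟩ := eventually_const_of_mono (fun k => (f k : ℤ) - q * k) C k0
    (fun k hk => by have := hm k hk; zify at this; push_cast; linarith)
    (fun k hk => by have := hb k hk; linarith)
  refine ⟨q, b, ?_⟩
  filter_upwards [eventually_ge_atTop N] with k hk
  have := h k hk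
  have h2 : (f k : ℤ) = q * k + b := by linarith
  exact_mod_cast h2

lemma EL.residue (S : ℕ → Set ℤ) (w ρ s t : ℤ) (hw : 0 < w)
    (h1 : ∀ k, S k ⊆ S (k + 1)) (h2 : ∀ k, ∀ x ∈ S k, x + w ∈ S (k + 1))
    (hb : ∀ k, ∀ x ∈ S k, s ≤ x ∧ x ≤ w * k + t) (hr : ∀ k, ∀ x ∈ S k, x % w = ρ) :
    EL (fun k => (S k).ncard) := by
  have hfin : ∀ k, (S k).Finite := fun k =>
    (Set.finite_Icc s (w * k + t)).subset (fun x hx => hb k x hx)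
  by_cases hne : ∃ k, (S k).Nonempty
  swap
  · push Not at hne
    exact ⟨0, 0, by simp [hne]⟩
  obtain ⟨k0, hk0⟩ := hne
  have hne : ∀ k ≥ k0, (S k).Nonempty := by
    intro k hk
    induction k, hk using Nat.le_induction with
    | base => exact hk0
    | succ l hl ih => exact ih.mono (h1 l)
  refine EL.of_mono _ 1 (|t / w + 1 - s / w|) k0 ?_ ?_
  · intro k hk
    obtain ⟨m, hm, hmin⟩ := Set.exists_min_image (S k) id (hfin k) (hne k hk)
    have hnot : m ∉ (fun x => x + w) '' S k := by
      rintro ⟨x, hx, hxm⟩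
      have := hmin x hx
      simp at this hxm
      omega
    have hsub : insert m ((fun x => x + w) '' S k) ⊆ S (k + 1) := by
      intro y hy
      rcases hy with rfl | ⟨x, hx, rfl⟩
      · exact h1 k hm
      · exact h2 k x hx
    have := Set.ncard_le_ncard hsub (hfin _)
    rw [Set.ncard_insert_of_notMem hnot ((hfin k).image _),
      Set.ncard_image_of_injective _ (add_left_injective w)] at this
    exact this
  · intro k hk
    have hinj : Set.InjOn (fun x : ℤ => x / w) (S k) := by
      intro x hx y hy hxy
      have e1 := hr k x hx
      have e2 := hr k y hy
      have := Int.emod_add_mul_ediv x w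
      have := Int.emod_add_mul_ediv y w
      simp only at hxy
      rw [hxy] at *
      omega
    have hsub : (fun x : ℤ => x / w) '' S k ⊆ (Finset.Icc (s / w) (k + t / w) : Finset ℤ) := by
      rintro _ ⟨x, hx, rfl⟩
      obtain ⟨l, u⟩ := hb k x hx
      simp only [Finset.coe_Icc, Set.mem_Icc]
      refine ⟨Int.ediv_le_ediv hw l, ?_⟩
      have := Int.ediv_le_ediv hw u
      rwa [Int.mul_add_ediv_left _ _ hw.ne'] at this
    have := Set.ncard_le_ncard hsub (Finset.finite_toSet _)
    rw [hinj.ncard_image, Set.ncard_coe_finset, Int.card_Icc] at this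
    have h3 := le_abs_self (t / w + 1 - s / w)
    have h4 := abs_nonneg (t / w + 1 - s / w)
    push_cast
    omega

lemma EL.sets (A : ℕ → Set ℤ) (α β s t : ℤ) (hαβ : α ≤ β)
    (h1 : ∀ k, ∀ x ∈ A k, x + α ∈ A (k + 1)) (h2 : ∀ k, ∀ x ∈ A k, x + β ∈ A (k + 1))
    (hb : ∀ k : ℕ, ∀ x ∈ A k, α * k + s ≤ x ∧ x ≤ β * k + t) : EL (fun k => (A k).ncard) := by
  classical
  have hfin : ∀ k, (A k).Finite := fun k =>
    (Set.finite_Icc (α * k + s) (β * k + t)).subset (fun x hx => hb k x hx)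
  rcases hαβ.eq_or_lt with heq | hlt
  · subst heq
    refine EL.of_mono _ 0 (t + 1 - s).toNat 0 ?_ ?_
    · intro k _
      have hsub : (fun x => x + α) '' A k ⊆ A (k + 1) := by
        rintro _ ⟨x, hx, rfl⟩; exact h1 k x hx
      have := Set.ncard_le_ncard hsub (hfin _)
      rwa [Set.ncard_image_of_injective _ (add_left_injective α)] at this
    · intro k _
      have hsub : A k ⊆ (Finset.Icc (α * k + s) (α * k + t) : Finset ℤ) := by
        intro x hx; simpa using hb k x hx
      have := Set.ncard_le_ncard hsub (Finset.finite_toSet _)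
      rw [Set.ncard_coe_finset, Int.card_Icc] at this
      push_cast
      omega
  · obtain ⟨w, hw⟩ : ∃ w, w = β - α := ⟨_, rfl⟩
    have hw0 : 0 < w := by omega
    let S : ℤ → ℕ → Set ℤ := fun ρ k => {x | x + α * k ∈ A k ∧ x % w = ρ}
    have hS : ∀ ρ, EL (fun k => (S ρ k).ncard) := by
      intro ρ
      refine EL.residue (S ρ) w ρ s t hw0 ?_ ?_ ?_ ?_
      · rintro k x ⟨hx, hr⟩
        refine ⟨?_, hr⟩
        have := h1 k _ hx
        convert this using 1
        push_cast; ring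
      · rintro k x ⟨hx, hr⟩
        refine ⟨?_, by simpa using hr⟩
        have := h2 k _ hx
        convert this using 1
        rw [hw]; push_cast; ring
      · rintro k x ⟨hx, hr⟩
        have := hb k _ hx
        rw [hw]
        constructor <;> linarith
      · rintro k x ⟨hx, hr⟩; exact hr
    have := EL.sum (Finset.Ico 0 w) (fun ρ k => (S ρ k).ncard) (fun ρ _ => hS ρ)
    convert this using 2 with k
    let F : Finset ℤ := (hfin k).toFinset
    have e1 : (A k).ncard = F.card := Set.ncard_eq_toFinset_card _ (hfin k)
    rw [e1, Finset.card_eq_sum_card_fiberwise (f := fun x => (x - α * k) % w)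
      (t := Finset.Ico 0 w)]
    · refine Finset.sum_congr rfl fun ρ _ => ?_
      have : S ρ k = (fun x => x - α * k) '' ((F.filter (fun x => (x - α * k) % w = ρ) : Finset ℤ) : Set ℤ) := by
        ext x
        simp only [S, F, Set.mem_ofPred_eq, Finset.coe_filter, Set.Finite.mem_toFinset,
          Set.mem_image]
        constructor
        · rintro ⟨hx, hr⟩
          exact ⟨x + α * k, ⟨hx, by simpa using hr⟩, by ring⟩
        · rintro ⟨y, ⟨hy, hr⟩, rfl⟩
          exact ⟨by simpa using hy, hr⟩
      rw [this, Set.ncard_image_of_injective _ (sub_left_injective), Set.ncard_coe_finset]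
    · intro x _
      simp only [Finset.coe_Ico, Set.mem_Ico]
      exact ⟨Int.emod_nonneg _ hw0.ne', Int.emod_lt_of_pos _ hw0⟩

/-- cast of rational vectors -/
def castV {d : ℕ} (v : Fin d → ℚ) : Fin d → ℝ := fun i => ((v i : ℚ) : ℝ)

lemma exists_denom {d : ℕ} (V : Finset (Fin d → ℚ)) :
    ∃ D : ℕ, 0 < D ∧ ∀ v ∈ V, ∃ u : Fin d → ℤ, ∀ i, (D : ℚ) * v i = u i := by
  refine ⟨∏ v ∈ V, ∏ i, (v i).den, ?_, ?_⟩
  · exact Finset.prod_pos fun v _ => Finset.prod_pos fun i _ => (v i).den_pos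
  · intro v hv
    have hd : ∀ i, (v i).den ∣ ∏ v ∈ V, ∏ i, (v i).den := fun i =>
      (Finset.dvd_prod_of_mem (fun i => (v i).den) (Finset.mem_univ i)).trans
        (Finset.dvd_prod_of_mem (fun v : Fin d → ℚ => ∏ i, (v i).den) hv)
    choose q hq using hd
    refine ⟨fun i => q i * (v i).num, fun i => ?_⟩
    rw [hq i]
    push_cast
    have := Rat.den_mul_eq_num (v i)
    linear_combination (q i : ℚ) * this

lemma hull_le {d : ℕ} (V : Finset (Fin d → ℚ)) (c : Fin d → ℝ) (M : ℝ)
    (h : ∀ v ∈ V, ∑ i, c i * (v i : ℝ) ≤ M) (x : Fin d → ℝ)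
    (hx : x ∈ convexHull ℝ (castV '' (V : Set (Fin d → ℚ)))) : ∑ i, c i * x i ≤ M := by
  have hc : Convex ℝ {x : Fin d → ℝ | ∑ i, c i * x i ≤ M} := by
    refine convex_halfSpace_le (f := fun x : Fin d → ℝ => ∑ i, c i * x i) ?_ M
    constructor
    · intro x y; simp [mul_add, Finset.sum_add_distrib]
    · intro a x; simp [Finset.mul_sum, mul_left_comm]
  exact convexHull_min (by rintro _ ⟨v, hv, rfl⟩; exact h v hv) hc hx

lemma aw_EL {d : ℕ} (V : Finset (Fin d → ℚ)) (hV : V.Nonempty) (D : ℕ) (hD : 0 < D)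
    (hden : ∀ v ∈ V, ∃ u : Fin d → ℤ, ∀ i, (D : ℚ) * v i = u i) (r : ℕ) (c : Fin d → ℤ) :
    EL (fun k => aw c (((D * k + r : ℕ) : ℝ) • convexHull ℝ (castV '' (V : Set (Fin d → ℚ)))))
      ∧ ∀ n : ℕ, (AR c ((n : ℝ) • convexHull ℝ (castV '' (V : Set (Fin d → ℚ))))).Finite := by
  set P := convexHull ℝ (castV '' (V : Set (Fin d → ℚ))) with hP
  have hconv : Convex ℝ P := convex_convexHull ℝ _
  obtain ⟨v₁, hv₁, hmin⟩ := V.exists_min_image (fun v => ∑ i, (c i : ℚ) * v i) hV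
  obtain ⟨v₂, hv₂, hmax⟩ := V.exists_max_image (fun v => ∑ i, (c i : ℚ) * v i) hV
  set m₁ : ℚ := ∑ i, (c i : ℚ) * v₁ i with hm₁
  set m₂ : ℚ := ∑ i, (c i : ℚ) * v₂ i with hm₂
  have hup : ∀ x ∈ P, ∑ i, (c i : ℝ) * x i ≤ m₂ := by
    intro x hx
    refine hull_le V (fun i => (c i : ℝ)) m₂ ?_ x hx
    intro v hv
    exact_mod_cast hmax v hv
  have hlo : ∀ x ∈ P, (m₁ : ℝ) ≤ ∑ i, (c i : ℝ) * x i := by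
    intro x hx
    have := hull_le V (fun i => -(c i : ℝ)) (-m₁) ?_ x hx
    · simpa using this
    intro v hv
    simp only [neg_mul, Finset.sum_neg_distrib, neg_le_neg_iff]
    exact_mod_cast hmin v hv
  have hbd : ∀ n : ℕ, ∀ x ∈ AR c ((n : ℝ) • P), (n : ℝ) * m₁ ≤ x ∧ (x : ℝ) ≤ n * m₂ := by
    rintro n _ ⟨x, ⟨y, hy, hxy⟩, rfl⟩
    have : (((∑ i, c i * x i : ℤ)) : ℝ) = n * ∑ i, (c i : ℝ) * y i := by
      push_cast
      rw [Finset.mul_sum]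
      refine Finset.sum_congr rfl fun i _ => ?_
      have := congrFun hxy i
      simp at this
      rw [← this]; ring
    rw [this]
    exact ⟨mul_le_mul_of_nonneg_left (hlo y hy) (by positivity),
      mul_le_mul_of_nonneg_left (hup y hy) (by positivity)⟩
  have hfin : ∀ n : ℕ, (AR c ((n : ℝ) • P)).Finite := by
    intro n
    refine (Set.finite_Icc ⌈(n : ℝ) * m₁⌉ ⌊(n : ℝ) * m₂⌋).subset fun x hx => ?_
    exact ⟨Int.ceil_le.2 (hbd n x hx).1, Int.le_floor.2 (hbd n x hx).2⟩
  refine ⟨?_, hfin⟩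
  have key : ∀ v ∈ V, ∃ α : ℤ, (α : ℚ) = D * ∑ i, (c i : ℚ) * v i ∧ ∀ k : ℕ,
      ∀ x ∈ AR c (((D * k + r : ℕ) : ℝ) • P), x + α ∈ AR c (((D * (k + 1) + r : ℕ) : ℝ) • P) := by
    intro v hv
    obtain ⟨u, hu⟩ := hden v hv
    refine ⟨∑ i, c i * u i, ?_, ?_⟩
    · push_cast
      rw [Finset.mul_sum]
      refine Finset.sum_congr rfl fun i _ => ?_
      rw [← hu i]; ring
    · rintro k _ ⟨x, hx, rfl⟩
      refine ⟨x + u, ?_, ?_⟩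
      · have e : ((D * (k + 1) + r : ℕ) : ℝ) = ((D * k + r : ℕ) : ℝ) + (D : ℝ) := by
          push_cast; ring
        show (fun i => (((x + u) i : ℤ) : ℝ)) ∈ ((D * (k + 1) + r : ℕ) : ℝ) • P
        rw [e, hconv.add_smul (by positivity) (by positivity)]
        refine Set.mem_add.2 ⟨_, hx, (D : ℝ) • castV v,
          Set.smul_mem_smul_set (subset_convexHull ℝ _ ⟨v, hv, rfl⟩), ?_⟩
        ext i
        have : (D : ℝ) * (v i : ℝ) = u i := by exact_mod_cast hu i
        simp [castV, this]
      · simp [mul_add, Finset.sum_add_distrib]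
  obtain ⟨α, hα, hα'⟩ := key v₁ hv₁
  obtain ⟨β, hβ, hβ'⟩ := key v₂ hv₂
  have hDq : (0 : ℚ) < D := by exact_mod_cast hD
  refine EL.sets (fun k => AR c (((D * k + r : ℕ) : ℝ) • P)) α β ⌊(r : ℚ) * m₁⌋ ⌈(r : ℚ) * m₂⌉
    ?_ hα' hβ' ?_
  · have : (α : ℚ) ≤ β := by
      rw [hα, hβ]
      exact mul_le_mul_of_nonneg_left (hmin v₂ hv₂) hDq.le
    exact_mod_cast this
  · intro k x hx
    obtain ⟨l, h⟩ := hbd _ x hx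
    have l' : ((D * k + r : ℕ) : ℚ) * m₁ ≤ x := by exact_mod_cast l
    have h' : (x : ℚ) ≤ ((D * k + r : ℕ) : ℚ) * m₂ := by exact_mod_cast h
    push_cast at l' h'
    have f1 := Int.floor_le ((r : ℚ) * m₁)
    have f2 := Int.le_ceil ((r : ℚ) * m₂)
    constructor
    · have : ((α * k + ⌊(r : ℚ) * m₁⌋ : ℤ) : ℚ) ≤ x := by
        push_cast; rw [hα]; linarith
      exact_mod_cast this
    · have : (x : ℚ) ≤ ((β * k + ⌈(r : ℚ) * m₂⌉ : ℤ) : ℚ) := by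
        push_cast; rw [hβ]; linarith
      exact_mod_cast this

lemma aw_smul {d : ℕ} (t : ℤ) (ht : t ≠ 0) (c : Fin d → ℤ) (K : Set (Fin d → ℝ)) :
    aw (fun i => t * c i) K = aw c K := by
  have : AR (fun i => t * c i) K = (fun x => t * x) '' AR c K := by
    ext x
    constructor
    · rintro ⟨y, hy, rfl⟩
      exact ⟨_, ⟨y, hy, rfl⟩, by simp [Finset.mul_sum, mul_assoc]⟩
    · rintro ⟨_, ⟨y, hy, rfl⟩, rfl⟩
      exact ⟨y, hy, by simp [Finset.mul_sum, mul_assoc]⟩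
  unfold aw
  rw [this, Set.ncard_image_of_injective _ (mul_right_injective₀ ht)]

lemma aw_box {d : ℕ} (c : Fin d → ℤ) (K : Set (Fin d → ℝ)) (hfin : (AR c K).Finite)
    (z : Fin d → ℤ) (m B : ℕ) (hB : B < m)
    (hbox : ∀ x : Fin d → ℤ, (∀ i, 0 ≤ x i ∧ x i < m) → z + x ∈ intPts K)
    (i j : Fin d) (hj : c j ≠ 0) (hdvd : ¬ c j ∣ (B.factorial : ℤ) * c i) :
    (B + 1) * m ≤ aw c K := by
  classical
  have hij : i ≠ j := by
    rintro rfl; exact hdvd (Dvd.intro_left _ rfl)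
  let g : ℕ × ℕ → ℤ := fun p => ∑ l, c l * z l + (c i * p.1 + c j * p.2)
  have hinj : Set.InjOn g ((Finset.range (B + 1) ×ˢ Finset.range m : Finset (ℕ × ℕ)) : Set _) := by
    rintro ⟨y, x⟩ h1 ⟨y', x'⟩ h2 he
    simp only [Finset.coe_product, Finset.coe_range, Set.mem_prod, Set.mem_Iio] at h1 h2
    simp only [g, add_right_inj] at he
    have e : c i * ((y : ℤ) - y') = c j * (x' - x) := by linarith
    have hy : y = y' := by
      by_contra hne
      have hd : ((y : ℤ) - y') ∣ (B.factorial : ℤ) := by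
        rw [← Int.natAbs_dvd]
        exact Int.natCast_dvd_natCast.2 (Nat.dvd_factorial (by omega) (by omega))
      obtain ⟨q, hq⟩ := hd
      apply hdvd
      refine ⟨q * (x' - x), ?_⟩
      rw [hq]; linear_combination q * e
    subst hy
    have : c j * ((x' : ℤ) - x) = 0 := by rw [← e]; ring
    have := (mul_eq_zero.1 this).resolve_left hj
    have : x = x' := by omega
    rw [this]
  have hsub : ((Finset.image g (Finset.range (B + 1) ×ˢ Finset.range m) : Finset ℤ) : Set ℤ) ⊆ AR c K := by
    intro t ht
    simp only [Finset.coe_image, Set.mem_image, Finset.coe_product, Finset.coe_range, Set.mem_prod, Set.mem_Iio] at ht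
    obtain ⟨⟨y, x⟩, ⟨hy, hx⟩, rfl⟩ := ht
    simp only at hx hy
    refine ⟨z + (Pi.single i (y : ℤ) + Pi.single j (x : ℤ)), hbox _ ?_, ?_⟩
    · intro l
      simp only [Pi.add_apply, Pi.single_apply]
      split_ifs <;> first | (exfalso; apply hij; simp_all; done) | (constructor <;> omega)
    · simp [g, mul_add, Finset.sum_add_distrib, Pi.single_apply]
  have := Set.ncard_le_ncard hsub hfin
  rw [Set.ncard_coe_finset, Finset.card_image_of_injOn hinj] at this
  simpa [aw] using this

lemma aw_dichotomy {d : ℕ} (c : Fin d → ℤ) (hc : c ≠ 0) (K : Set (Fin d → ℝ))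
    (hfin : (AR c K).Finite)
    (z : Fin d → ℤ) (m B : ℕ) (hB : B < m)
    (hbox : ∀ x : Fin d → ℤ, (∀ i, 0 ≤ x i ∧ x i < m) → z + x ∈ intPts K) :
    (B + 1) * m ≤ aw c K ∨ ∃ c' : Fin d → ℤ, c' ≠ 0 ∧ (∀ i, |c' i| ≤ B.factorial) ∧
      aw c' K = aw c K := by
  obtain ⟨i0, hi0⟩ := Function.ne_iff.1 hc
  obtain ⟨j, -, hmax⟩ := Finset.univ.exists_max_image (fun i => |c i|) ⟨i0, Finset.mem_univ _⟩
  have hj : c j ≠ 0 := by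
    intro h
    have := hmax i0 (Finset.mem_univ _)
    simp [h] at this
    exact hi0 this
  have hF : (B.factorial : ℤ) ≠ 0 := by exact_mod_cast B.factorial_ne_zero
  by_cases h : ∃ i, ¬ c j ∣ (B.factorial : ℤ) * c i
  · obtain ⟨i, hi⟩ := h
    exact Or.inl (aw_box c K hfin z m B hB hbox i j hj hi)
  · right
    push Not at h
    choose c' hc' using h
    refine ⟨c', ?_, ?_, ?_⟩
    · rintro rfl
      have := hc' j
      rw [Pi.zero_apply, mul_zero] at this
      exact mul_ne_zero hF hj this
    · intro i
      have h1 := congrArg abs (hc' i)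
      rw [abs_mul, abs_mul, Nat.abs_cast] at h1
      have h2 := hmax i (Finset.mem_univ _)
      have h3 : 0 < |c j| := abs_pos.2 hj
      have h4 : (B.factorial : ℤ) * |c i| ≤ B.factorial * |c j| :=
        mul_le_mul_of_nonneg_left h2 (by positivity)
      rw [h1, mul_comm] at h4
      exact le_of_mul_le_mul_right h4 h3
    · rw [← aw_smul (c j) hj c' K, ← aw_smul _ hF c K]
      congr 1
      funext i
      exact (hc' i).symm

/-- flat polytopes admit an integer direction in which they are constant -/
lemma flat_or_interior {d : ℕ} (V : Finset (Fin d → ℚ)) (hV : V.Nonempty) :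
    (∃ c : Fin d → ℤ, c ≠ 0 ∧ ∃ M : ℝ, ∀ x ∈ convexHull ℝ (castV '' (V : Set (Fin d → ℚ))),
      ∑ i, (c i : ℝ) * x i = M) ∨
    (interior (convexHull ℝ (castV '' (V : Set (Fin d → ℚ))))).Nonempty := by
  classical
  obtain ⟨v₀, hv₀⟩ := hV
  let W : Submodule ℚ (Fin d → ℚ) := Submodule.span ℚ ((fun v => v - v₀) '' (V : Set (Fin d → ℚ)))
  by_cases hW : W = ⊤
  · right
    rw [interior_convexHull_nonempty_iff_affineSpan_eq_top,
      AffineSubspace.affineSpan_eq_top_iff_vectorSpan_eq_top_of_nonempty ℝ (Fin d → ℝ) (Fin d → ℝ) (s := castV '' (V : Set (Fin d → ℚ))) ((⟨_, v₀, hv₀, rfl⟩ :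
        (castV '' (V : Set (Fin d → ℚ))).Nonempty))]
    set U := vectorSpan ℝ (castV '' (V : Set (Fin d → ℚ))) with hU
    have hmem : ∀ x ∈ W, castV x ∈ U := by
      intro x hx
      induction hx using Submodule.span_induction with
      | mem x hx =>
        obtain ⟨v, hv, rfl⟩ := hx
        have : castV (v - v₀) = castV v -ᵥ castV v₀ := by
          ext i; simp [castV]
        simp only [this]
        exact vsub_mem_vectorSpan ℝ ⟨v, hv, rfl⟩ ⟨v₀, hv₀, rfl⟩
      | zero =>
        have : castV (0 : Fin d → ℚ) = 0 := by ext i; simp [castV]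
        rw [this]; exact U.zero_mem
      | add x y _ _ h1 h2 =>
        have : castV (x + y) = castV x + castV y := by ext i; simp [castV]
        rw [this]; exact U.add_mem h1 h2
      | smul a x _ h =>
        have : castV (a • x) = (a : ℝ) • castV x := by ext i; simp [castV]
        rw [this]; exact U.smul_mem _ h
    rw [eq_top_iff]
    intro x _
    have hx : x = ∑ i, x i • castV (Pi.single i 1) := by
      ext l
      simp [castV, Pi.single_apply, Finset.sum_apply, apply_ite (fun q : ℚ => (q : ℝ))]
    rw [hx]
    refine U.sum_mem fun i _ => U.smul_mem _ (hmem _ ?_)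
    rw [hW]; trivial
  · left
    obtain ⟨f, hf, hle⟩ := Submodule.exists_le_ker_of_lt_top W (lt_top_iff_ne_top.2 hW)
    obtain ⟨D, hD, hden⟩ := exists_denom {fun i => f (Pi.single i 1)}
    obtain ⟨c, hc⟩ := hden _ (Finset.mem_singleton_self _)
    have hDq : (D : ℚ) ≠ 0 := by exact_mod_cast hD.ne'
    have hfe : ∀ x : Fin d → ℚ, ∑ i, (c i : ℚ) * x i = D * f x := by
      intro x
      have hx : x = ∑ i, x i • (Pi.single i (1 : ℚ) : Fin d → ℚ) := by
        ext l
        simp [Pi.single_apply, Finset.sum_apply]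
      conv_rhs => rw [hx]
      rw [map_sum, Finset.mul_sum]
      refine Finset.sum_congr rfl fun i _ => ?_
      rw [← hc i, map_smul, smul_eq_mul]
      ring
    refine ⟨c, ?_, ((∑ i, (c i : ℚ) * v₀ i : ℚ) : ℝ), ?_⟩
    · rintro rfl
      apply hf
      ext1 x
      have := hfe (Pi.single x 1)
      simp [hDq] at this
      ext
      simpa using this
    · have hv : ∀ v ∈ V, ∑ i, (c i : ℚ) * v i = ∑ i, (c i : ℚ) * v₀ i := by
        intro v hv
        have h1 : f (v - v₀) = 0 := hle (Submodule.subset_span ⟨v, hv, rfl⟩)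
        rw [map_sub, sub_eq_zero] at h1
        rw [hfe, hfe, h1]
      intro x hx
      apply le_antisymm
      · refine hull_le V (fun i => (c i : ℝ)) _ ?_ x hx
        intro v h
        rw [← hv v h]; push_cast; exact le_rfl
      · have := hull_le V (fun i => -(c i : ℝ)) (-((∑ i, (c i : ℚ) * v₀ i : ℚ) : ℝ)) ?_ x hx
        · simpa using this
        intro v h
        rw [← hv v h]; push_cast; simp

open Filter in
lemma main_class {d : ℕ} (V : Finset (Fin d → ℚ)) (hV : V.Nonempty) (D : ℕ) (hD : 0 < D)
    (hden : ∀ v ∈ V, ∃ u : Fin d → ℤ, ∀ i, (D : ℚ) * v i = u i) (r : ℕ) :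
    EL (fun k => awMin (((D * k + r : ℕ) : ℝ) • convexHull ℝ (castV '' (V : Set (Fin d → ℚ))))) := by
  classical
  rcases Nat.eq_zero_or_pos d with rfl | hd
  · refine ⟨0, 0, Eventually.of_forall fun k => ?_⟩
    have : ∀ K : Set (Fin 0 → ℝ), awMin K = 0 := by
      intro K
      unfold awMin
      convert Nat.sInf_empty
      ext m
      simp only [Set.mem_ofPred_eq, Set.mem_empty_iff_false, iff_false, not_exists]
      rintro c ⟨hc, -⟩
      exact hc (Subsingleton.elim _ _)
    simp [this]
  have hEL := aw_EL V hV D hD hden r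
  have hflat := flat_or_interior V hV
  set P := convexHull ℝ (castV '' (V : Set (Fin d → ℚ))) with hP
  -- reduction to a finite set
  suffices h : ∃ C : Finset (Fin d → ℤ), C.Nonempty ∧ (∀ c ∈ C, c ≠ 0) ∧
      ∀ᶠ k : ℕ in atTop, ∀ c : Fin d → ℤ, c ≠ 0 → ∃ c' ∈ C,
        aw c' (((D * k + r : ℕ) : ℝ) • P) ≤ aw c (((D * k + r : ℕ) : ℝ) • P) by
    obtain ⟨C, hC, hC0, hev⟩ := h
    obtain ⟨c, hc, hmin⟩ := EL.exists_min C hC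
      (fun c k => aw c (((D * k + r : ℕ) : ℝ) • P)) (fun c => (hEL c).1)
    obtain ⟨a, b, hab⟩ := (hEL c).1
    refine ⟨a, b, ?_⟩
    filter_upwards [hev, hmin, hab] with k h1 h2 h3
    rw [← h3]
    congr 1
    apply le_antisymm
    · exact Nat.sInf_le ⟨c, hC0 c hc, rfl⟩
    · refine le_csInf ⟨_, c, hC0 c hc, rfl⟩ ?_
      rintro _ ⟨c₁, hc₁, rfl⟩
      obtain ⟨c', hc', hle⟩ := h1 c₁ hc₁
      exact (h2 c' hc').trans hle
  rcases hflat with ⟨c, hc, M, hM⟩ | ⟨p, hp⟩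
  · refine ⟨{c}, by simp, by simpa using hc, Eventually.of_forall fun k c₁ hc₁ => ⟨c, by simp, ?_⟩⟩
    have hfin := (hEL c₁).2 (D * k + r)
    have hsub : (AR c (((D * k + r : ℕ) : ℝ) • P)).Subsingleton := by
      have : ∀ x ∈ AR c (((D * k + r : ℕ) : ℝ) • P), (x : ℝ) = ((D * k + r : ℕ) : ℝ) * M := by
        rintro _ ⟨x, ⟨y, hy, hxy⟩, rfl⟩
        rw [← hM y hy]
        push_cast
        rw [Finset.mul_sum]
        refine Finset.sum_congr rfl fun i _ => ?_
        have := congrFun hxy i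
        simp at this
        rw [← this]; ring
      intro x hx y hy
      have := (this x hx).trans (this y hy).symm
      exact_mod_cast this
    rcases Set.eq_empty_or_nonempty (AR c (((D * k + r : ℕ) : ℝ) • P)) with he | ⟨_, x, hx, -⟩
    · unfold aw
      rw [he, Set.ncard_empty]
      exact Nat.zero_le _
    · have h1 : aw c (((D * k + r : ℕ) : ℝ) • P) ≤ 1 :=
        (Set.ncard_le_one hsub.finite).2 (fun a ha b hb => hsub ha hb)
      have h2 : 0 < aw c₁ (((D * k + r : ℕ) : ℝ) • P) :=
        (Set.ncard_pos hfin).2 ⟨_, x, hx, rfl⟩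
      omega
  · obtain ⟨ρ', hρ', hball⟩ := Metric.nhds_basis_closedBall.mem_iff.1 (mem_interior_iff_mem_nhds.1 hp)
    obtain ⟨ρ, hρ, hρρ'⟩ := exists_rat_btwn hρ'
    have hρ0 : (0 : ℚ) < ρ := by exact_mod_cast hρ
    let c₀ : Fin d → ℤ := Pi.single ⟨0, hd⟩ 1
    have hc₀ : c₀ ≠ 0 := by simp [c₀]
    obtain ⟨a, b, hab⟩ := (hEL c₀).1
    obtain ⟨B, hB⟩ := exists_nat_gt (a / ρ)
    have hB' : a < B * ρ := (div_lt_iff₀ hρ0).1 hB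
    refine ⟨insert c₀ ((Fintype.piFinset fun _ => Finset.Icc (-(B.factorial : ℤ)) B.factorial).filter
      (· ≠ 0)), by simp, ?_, ?_⟩
    · intro c hc
      rcases Finset.mem_insert.1 hc with rfl | h
      · exact hc₀
      · exact (Finset.mem_filter.1 h).2
    filter_upwards [hab, eventually_lin ρ (B + 1) hρ0,
      eventually_lin ((B + 1) * ρ - a) (b + (B + 1)) (by linarith), eventually_gt_atTop 0]
      with k h1 h2 h3 hk c hc
    set n := D * k + r with hn
    have hkn : k ≤ n := by nlinarith
    have hn0 : 0 < n := by omega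
    have hnR : (0 : ℝ) < n := by exact_mod_cast hn0
    set m := ⌊(n : ℚ) * ρ⌋₊ with hm
    have hm1 : (m : ℚ) ≤ n * ρ := Nat.floor_le (by positivity)
    have hm2 : (n : ℚ) * ρ < m + 1 := Nat.lt_floor_add_one _
    have hkq : (k : ℚ) ≤ n := by exact_mod_cast hkn
    have hkρ : ρ * k ≤ n * ρ := by nlinarith
    have hBm : B < m := by
      apply Nat.lt_of_succ_le
      apply Nat.le_floor
      push_cast
      linarith
    have hbox : ∀ x : Fin d → ℤ, (∀ i, 0 ≤ x i ∧ x i < m) →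
        (fun i => ⌈(n : ℝ) * p i⌉) + x ∈ intPts ((n : ℝ) • P) := by
      intro x hx
      show (fun i => ((((fun i => ⌈(n : ℝ) * p i⌉) + x) i : ℤ) : ℝ)) ∈ (n : ℝ) • P
      rw [Set.mem_smul_set_iff_inv_smul_mem₀ hnR.ne']
      apply hball
      rw [Metric.mem_closedBall, dist_pi_le_iff hρ'.le]
      intro i
      have hm1' : (m : ℝ) ≤ n * ρ := by exact_mod_cast hm1
      have c1 := Int.le_ceil ((n : ℝ) * p i)
      have c2 := Int.ceil_lt_add_one ((n : ℝ) * p i)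
      have x1 : (0 : ℝ) ≤ x i := by exact_mod_cast (hx i).1
      have x2 : (x i : ℝ) + 1 ≤ m := by exact_mod_cast (hx i).2
      rw [Real.dist_eq]
      simp only [Pi.smul_apply, Pi.add_apply, smul_eq_mul, Int.cast_add]
      have e : (n : ℝ)⁻¹ * ((⌈(n : ℝ) * p i⌉ : ℝ) + x i) - p i
          = ((⌈(n : ℝ) * p i⌉ : ℝ) + x i - n * p i) / n := by
        field_simp
      rw [e, abs_of_nonneg (div_nonneg (by linarith) hnR.le), div_le_iff₀ hnR]
      nlinarith
    rcases aw_dichotomy c hc _ ((hEL c).2 n) _ m B hBm hbox with h | ⟨c', hc', hle, he⟩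
    · refine ⟨c₀, Finset.mem_insert_self _ _, le_trans ?_ h⟩
      have : (aw c₀ ((n : ℝ) • P) : ℚ) ≤ ((B + 1) * m : ℕ) := by
        rw [h1]
        push_cast
        have : ((B : ℚ) + 1) * (ρ * k) ≤ (B + 1) * (m + 1) :=
          mul_le_mul_of_nonneg_left (by linarith) (by positivity)
        nlinarith
      exact_mod_cast this
    · refine ⟨c', Finset.mem_insert_of_mem (Finset.mem_filter.2 ⟨?_, hc'⟩), he.le⟩
      rw [Fintype.mem_piFinset]
      intro i
      rw [Finset.mem_Icc]
      exact abs_le.1 (hle i)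

/-- for a rational polytope `P`, the function `n ↦ aw(nP)` is eventually
quasilinear: there are `D > 0`, a threshold `N`, and rationals `a_r, b_r` for
`r = 0, …, D−1` with `aw(nP) = a_{n mod D}·n + b_{n mod D}` for all `n ≥ N`. -/
theorem aw_eventually_quasilinear {d : ℕ} (P : Set (Fin d → ℝ))
    (hP : IsRatPolytope P) :
    ∃ (D : ℕ), 0 < D ∧ ∃ (N : ℕ) (a b : ℕ → ℚ),
      ∀ n : ℕ, N ≤ n →
        (awMin ((n : ℝ) • P) : ℚ) = a (n % D) * (n : ℚ) + b (n % D) := by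
  obtain ⟨V, hV, hPV⟩ := hP
  obtain ⟨D, hD, hden⟩ := exists_denom V
  have hmain := main_class V hV D hD hden
  have hPV' : P = convexHull ℝ (castV '' (V : Set (Fin d → ℚ))) := hPV
  rw [← hPV'] at hmain
  have hmain' : ∀ r, ∃ a b : ℚ, ∃ N : ℕ, ∀ k ≥ N,
      ((awMin (((D * k + r : ℕ) : ℝ) • P) : ℕ) : ℚ) = a * k + b := by
    intro r
    obtain ⟨a, b, h⟩ := hmain r
    exact ⟨a, b, Filter.eventually_atTop.1 h⟩
  choose a b N h using hmain'
  have hDq : (D : ℚ) ≠ 0 := by exact_mod_cast hD.ne'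
  refine ⟨D, hD, D * ((Finset.range D).sup N), fun r => a r / D, fun r => b r - a r * r / D,
    fun n hn => ?_⟩
  have hr : n % D < D := Nat.mod_lt _ hD
  have h1 : N (n % D) ≤ n / D := by
    rw [Nat.le_div_iff_mul_le hD, mul_comm]
    exact (Nat.mul_le_mul_left D (Finset.le_sup (Finset.mem_range.2 hr))).trans hn
  have h2 := h (n % D) (n / D) h1
  rw [Nat.div_add_mod] at h2
  rw [h2]
  have h3 : (D : ℚ) * ((n / D : ℕ) : ℚ) + ((n % D : ℕ) : ℚ) = n := by
    exact_mod_cast Nat.div_add_mod n D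
  have h4 : ((n / D : ℕ) : ℚ) = (n - ((n % D : ℕ) : ℚ)) / D := by
    rw [eq_div_iff hDq]; linarith
  rw [h4]
  field_simp
  ring
end

section
/- Let P ⊆ ℝ^d be a rational polytope with denominator D and let c ∈ ℤ^d be nonzero. Set m = min_{x∈P} c·x, M = max_{x∈P} c·x, let V be the linear span of P − P, and let λ ∈ ℤ_{≥0} be the nonnegative generator of the subgroup { c·w : w ∈ V ∩ ℤ^d } of ℤ. Then there exist γ ∈ ℚ_{≥0} with γ·λ = D·(M − m) and an integer N such that for every integer n ≥ N for which the affine span of nP contains a point of ℤ^d, one has aw_c((n+D)P) = aw_c(nP) + γ. -/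
open Pointwise

/-- `Q ⊆ ℝ^d` is an integral polytope: the convex hull of finitely many integer points. -/
def IsIntPolytope {d : ℕ} (Q : Set (Fin d → ℝ)) : Prop :=
  ∃ V : Finset (Fin d → ℤ), V.Nonempty ∧
    Q = convexHull ℝ ((fun v : Fin d → ℤ => (fun i => ((v i : ℤ) : ℝ))) '' (V : Set (Fin d → ℤ)))

/-- `D` is the denominator of `P`: the least positive integer such that `DP` is integral. -/
def IsDenom {d : ℕ} (P : Set (Fin d → ℝ)) (D : ℕ) : Prop :=
  0 < D ∧ IsIntPolytope ((D : ℝ) • P) ∧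
    ∀ D' : ℕ, 0 < D' → IsIntPolytope ((D' : ℝ) • P) → D ≤ D'


/-- `x` is a real combination of the integer vectors of `U` with total weight `s`. -/
def RepW {d : ℕ} (U : Finset (Fin d → ℤ)) (x : Fin d → ℝ) (s : ℝ) : Prop :=
  ∃ β : (Fin d → ℤ) → ℝ, x = ∑ u ∈ U, β u • (fun i => (u i : ℝ)) ∧ ∑ u ∈ U, β u = s

lemma RepW.add {d : ℕ} {U : Finset (Fin d → ℤ)} {x y : Fin d → ℝ} {s t : ℝ}
    (hx : RepW U x s) (hy : RepW U y t) : RepW U (x + y) (s + t) := by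
  obtain ⟨β, rfl, rfl⟩ := hx
  obtain ⟨β', rfl, rfl⟩ := hy
  exact ⟨fun u => β u + β' u, by simp [add_smul, Finset.sum_add_distrib],
    by simp [Finset.sum_add_distrib]⟩

lemma RepW.smul {d : ℕ} {U : Finset (Fin d → ℤ)} {x : Fin d → ℝ} {s : ℝ}
    (r : ℝ) (hx : RepW U x s) : RepW U (r • x) (r * s) := by
  obtain ⟨β, rfl, rfl⟩ := hx
  exact ⟨fun u => r * β u, by simp [Finset.smul_sum, mul_smul], by simp [Finset.mul_sum]⟩

lemma RepW.zero {d : ℕ} (U : Finset (Fin d → ℤ)) : RepW U 0 0 :=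
  ⟨fun _ => 0, by simp, by simp⟩

lemma RepW.of_mem {d : ℕ} {U : Finset (Fin d → ℤ)} {u : Fin d → ℤ} (hu : u ∈ U) :
    RepW U (fun i => (u i : ℝ)) 1 := by
  classical
  exact ⟨fun v => if v = u then 1 else 0, by simp [hu], by simp [hu]⟩

lemma RepW.of_convexHull {d : ℕ} {U : Finset (Fin d → ℤ)} {x : Fin d → ℝ}
    (hx : x ∈ convexHull ℝ ((fun v : Fin d → ℤ => (fun i => ((v i : ℤ) : ℝ))) ''
      (U : Set (Fin d → ℤ)))) : RepW U x 1 := by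
  have : convexHull ℝ ((fun v : Fin d → ℤ => (fun i => ((v i : ℤ) : ℝ))) ''
      (U : Set (Fin d → ℤ))) ⊆ {x | RepW U x 1} := by
    apply convexHull_min
    · rintro _ ⟨u, hu, rfl⟩
      exact RepW.of_mem hu
    · intro x hx y hy p q _ _ hpq
      have := (RepW.smul p hx).add (RepW.smul q hy)
      simpa [hpq] using this
  exact this hx

lemma RepW.of_mem_P {d : ℕ} {U : Finset (Fin d → ℤ)} {P : Set (Fin d → ℝ)} {D : ℕ} (hD : 0 < D)
    (hU : (D : ℝ) • P = convexHull ℝ ((fun v : Fin d → ℤ => (fun i => ((v i : ℤ) : ℝ))) ''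
      (U : Set (Fin d → ℤ)))) {x : Fin d → ℝ} (hx : x ∈ P) : RepW U x (1 / D) := by
  have h1 : (D : ℝ) • x ∈ (D : ℝ) • P := Set.smul_mem_smul_set hx
  rw [hU] at h1
  have h2 := (RepW.of_convexHull h1).smul (1 / D : ℝ)
  have : (D : ℝ) ≠ 0 := by positivity
  simpa [smul_smul, this] using h2

lemma RepW.of_span {d : ℕ} {U : Finset (Fin d → ℤ)} {P : Set (Fin d → ℝ)} {D : ℕ} (hD : 0 < D)
    (hU : (D : ℝ) • P = convexHull ℝ ((fun v : Fin d → ℤ => (fun i => ((v i : ℤ) : ℝ))) ''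
      (U : Set (Fin d → ℤ)))) {x : Fin d → ℝ} (hx : x ∈ Submodule.span ℝ (P - P)) :
    RepW U x 0 := by
  induction hx using Submodule.span_induction with
  | mem x h =>
    obtain ⟨p, hp, q, hq, rfl⟩ := Set.mem_sub.1 h
    have := (RepW.of_mem_P hD hU hp).add ((RepW.of_mem_P hD hU hq).smul (-1))
    simpa [sub_eq_add_neg] using this
  | zero => exact RepW.zero U
  | add x y _ _ hx hy => simpa using hx.add hy
  | smul a x _ hx => simpa using hx.smul a

lemma RepW.of_affineSpan {d : ℕ} {U : Finset (Fin d → ℤ)} {P : Set (Fin d → ℝ)} {D : ℕ}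
    (hD : 0 < D)
    (hU : (D : ℝ) • P = convexHull ℝ ((fun v : Fin d → ℤ => (fun i => ((v i : ℤ) : ℝ))) ''
      (U : Set (Fin d → ℤ)))) {n : ℕ} {x : Fin d → ℝ} (hx : x ∈ affineSpan ℝ ((n : ℝ) • P)) :
    RepW U x (n / D) := by
  refine affineSpan_induction (p := fun x => RepW U x (n / D)) hx ?_ ?_
  · intro x h
    obtain ⟨p, hp, rfl⟩ := h
    have := (RepW.of_mem_P hD hU hp).smul (n : ℝ)
    simpa [div_eq_mul_inv] using this
  · intro r u v w hu hv hw
    have := ((hu.add (hv.smul (-1))).smul r).add hw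
    simpa [sub_eq_add_neg] using this

/-- Nonnegative combinations lie in the dilate. -/
lemma mem_dilate {d : ℕ} {U : Finset (Fin d → ℤ)} {P : Set (Fin d → ℝ)} {D : ℕ}
    (hD : 0 < D)
    (hU : (D : ℝ) • P = convexHull ℝ ((fun v : Fin d → ℤ => (fun i => ((v i : ℤ) : ℝ))) ''
      (U : Set (Fin d → ℤ)))) {n : ℕ} (hn : 0 < n) (β : (Fin d → ℤ) → ℝ)
    (h0 : ∀ u ∈ U, 0 ≤ β u) (h1 : ∑ u ∈ U, β u = n / D) :
    ∑ u ∈ U, β u • (fun i => (u i : ℝ)) ∈ (n : ℝ) • P := by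
  have hD' : (D : ℝ) ≠ 0 := by positivity
  have hn' : (n : ℝ) ≠ 0 := by positivity
  have h2 : ∑ u ∈ U, (D / n * β u) • (fun i => (u i : ℝ)) ∈ (D : ℝ) • P := by
    rw [hU]
    apply (convex_convexHull ℝ _).sum_mem
    · intro u hu
      have := h0 u hu
      positivity
    · rw [← Finset.mul_sum, h1]
      field_simp
    · intro u hu
      exact subset_convexHull ℝ _ ⟨u, hu, rfl⟩
  obtain ⟨p, hp, hpe⟩ := h2
  refine ⟨p, hp, ?_⟩
  have h3 : p = (1 / D : ℝ) • ((D : ℝ) • p) := by simp [smul_smul, hD']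
  simp only at hpe ⊢
  rw [h3, hpe, Finset.smul_sum, Finset.smul_sum]
  refine Finset.sum_congr rfl fun u _ => ?_
  rw [smul_smul, smul_smul]
  congr 1
  field_simp

lemma eventually_const (f : ℕ → ℕ) (good : ℕ → Prop) (D γ N : ℕ) (hD : 0 < D)
    (hgood : ∀ n, good n → good (n + D))
    (hgrow : ∀ n, N ≤ n → good n → f n + γ ≤ f (n + D))
    (hbd : ∀ n, D * f n ≤ n * γ + D) :
    ∃ N', ∀ n, N' ≤ n → good n → f (n + D) = f n + γ := by
  classical
  let e : ℕ → ℕ := fun n => n * γ + D - D * f n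
  have hmono : ∀ n, N ≤ n → good n → e (n + D) ≤ e n := by
    intro n hn hg
    have h1 := Nat.mul_le_mul_left D (hgrow n hn hg)
    simp only [e, add_mul]
    rw [mul_add] at h1
    omega
  have hmono' : ∀ n, N ≤ n → good n → ∀ k, good (n + D * k) ∧ e (n + D * k) ≤ e n := by
    intro n hn hg k
    induction k with
    | zero => simpa using hg
    | succ k ih =>
      have h1 := hgood _ ih.1
      have h2 := hmono _ (by omega) ih.1
      rw [mul_add, mul_one, ← add_assoc]
      exact ⟨h1, h2.trans ih.2⟩
  have key : ∀ r : ℕ, ∃ K, ∀ n, K ≤ n → n % D = r → good n → f (n + D) = f n + γ := by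
    intro r
    by_cases hex : ∃ v n, N ≤ n ∧ n % D = r ∧ good n ∧ e n = v
    · obtain ⟨n0, hn0, hr0, hg0, he0⟩ := Nat.find_spec hex
      have hmin : ∀ n, N ≤ n → n % D = r → good n → e n0 ≤ e n := by
        intro n hn hr hg
        rw [he0]
        exact Nat.find_min' hex ⟨n, hn, hr, hg, rfl⟩
      refine ⟨n0, fun n hn hr hg => ?_⟩
      obtain ⟨k, hk⟩ := (Nat.modEq_iff_dvd' hn).1 (show n0 % D = n % D by omega)
      have hnk : n = n0 + D * k := by omega
      have h1 := (hmono' n0 hn0 hg0 k).2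
      rw [← hnk] at h1
      have h2 := hmin (n + D) (by omega) (by simpa using hr) (hgood n hg)
      have h3 := hmono n (by omega) hg
      have h4 := hgrow n (by omega) hg
      have h5 := hbd n
      have h6 := hbd (n + D)
      have h7 : e (n + D) = e n := by omega
      simp only [e, add_mul] at h7 h6
      have h8 : D * f (n + D) = D * (f n + γ) := by
        rw [mul_add]; omega
      exact Nat.eq_of_mul_eq_mul_left hD h8
    · push Not at hex
      refine ⟨N, fun n hn hr hg => ?_⟩
      exact absurd rfl (hex (e n) n hn hr hg)
  choose K hK using key
  refine ⟨∑ r ∈ Finset.range D, K r, fun n hn hg => hK (n % D) n ?_ rfl hg⟩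
  exact (Finset.single_le_sum (f := K) (fun _ _ => Nat.zero_le _)
    (Finset.mem_range.2 (Nat.mod_lt n hD))).trans hn

lemma card_growth (A B : Set ℤ) (hA : A.Finite) (hB : B.Finite) (a b t0 : ℤ) (lam γ : ℕ)
    (hab : b = a + lam * γ) (hγ : lam = 0 → γ = 0)
    (h1 : ∀ x ∈ A, x + a ∈ B) (h2 : ∀ x ∈ A, x + b ∈ B)
    (h3 : ∀ i : ℕ, 1 ≤ i → i ≤ γ → t0 + lam * i ∈ B) : A.ncard + γ ≤ B.ncard := by
  classical
  lift A to Finset ℤ using hA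
  lift B to Finset ℤ using hB
  rw [Set.ncard_coe_finset, Set.ncard_coe_finset]
  simp only [Finset.mem_coe] at h1 h2 h3
  let A1 := (A.filter (· + a ≤ t0)).image (· + a)
  let A2 := (A.filter (¬ · + a ≤ t0)).image (· + b)
  let A3 := (Finset.Icc 1 γ).image (fun i : ℕ => t0 + lam * i)
  have c1 : A1.card = (A.filter (· + a ≤ t0)).card :=
    Finset.card_image_of_injective _ (add_left_injective a)
  have c2 : A2.card = (A.filter (¬ · + a ≤ t0)).card :=
    Finset.card_image_of_injective _ (add_left_injective b)
  have c3 : A3.card = γ := by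
    rcases Nat.eq_zero_or_pos lam with h | h
    · simp [A3, hγ h]
    · rw [Finset.card_image_of_injective]
      · simp
      · intro i j hij
        simpa [h.ne'] using hij
  have c12 := Finset.card_filter_add_card_filter_not (s := A) (fun x => x + a ≤ t0)
  have d12 : Disjoint A1 A2 := by
    rw [Finset.disjoint_left]
    intro x hx hx'
    simp only [A1, A2, Finset.mem_image, Finset.mem_filter] at hx hx'
    obtain ⟨y, ⟨_, hy⟩, rfl⟩ := hx
    obtain ⟨y', ⟨_, hy'⟩, h⟩ := hx'
    have : (0 : ℤ) ≤ lam * γ := by positivity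
    omega
  have d3 : Disjoint (A1 ∪ A2) A3 := by
    rw [Finset.disjoint_left]
    intro x hx hx'
    simp only [A1, A2, A3, Finset.mem_union, Finset.mem_image, Finset.mem_filter,
      Finset.mem_Icc] at hx hx'
    obtain ⟨i, ⟨hi, hi'⟩, rfl⟩ := hx'
    have hl : 0 < lam := by
      rcases Nat.eq_zero_or_pos lam with h | h
      · have := hγ h; omega
      · exact h
    have e1 : (lam : ℤ) * i ≤ lam * γ := by gcongr
    have e2 : (0 : ℤ) < lam * i := by positivity
    rcases hx with ⟨y, ⟨_, hy⟩, h⟩ | ⟨y, ⟨_, hy⟩, h⟩ <;> omega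
  have hsub : (A1 ∪ A2) ∪ A3 ⊆ B := by
    intro x hx
    simp only [A1, A2, A3, Finset.mem_union, Finset.mem_image, Finset.mem_filter,
      Finset.mem_Icc] at hx
    rcases hx with (⟨y, ⟨hy, _⟩, rfl⟩ | ⟨y, ⟨hy, _⟩, rfl⟩) | ⟨i, ⟨hi, hi'⟩, rfl⟩
    · exact h1 y hy
    · exact h2 y hy
    · exact h3 i hi hi'
  have := Finset.card_le_card hsub
  rw [Finset.card_union_of_disjoint d3, Finset.card_union_of_disjoint d12] at this
  omega

lemma card_bound (A : Set ℤ) (a b : ℤ) (n D lam γ : ℕ) (hD : 0 < D)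
    (hab : b = a + lam * γ) (hA : A.Finite)
    (h1 : ∀ x ∈ A, n * a ≤ D * x ∧ D * x ≤ n * b)
    (h2 : ∀ x ∈ A, ∀ y ∈ A, (lam : ℤ) ∣ x - y) : D * A.ncard ≤ n * γ + D := by
  classical
  rcases A.eq_empty_or_nonempty with rfl | hne
  · simp
  obtain ⟨x0, hx0, hmin⟩ := hA.exists_minimalFor id A hne
  have hmin' : ∀ x ∈ A, x0 ≤ x := by
    intro x hx
    rcases le_total x0 x with h | h
    · exact h
    · exact hmin hx h
  have hsub : A ⊆ ((Finset.range (n * γ / D + 1)).image (fun q : ℕ => x0 + lam * q) : Finset ℤ) := by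
    intro x hx
    simp only [Finset.coe_image, Set.mem_image, Finset.mem_coe, Finset.mem_range]
    obtain ⟨q, hq⟩ := h2 x hx x0 hx0
    rcases Nat.eq_zero_or_pos lam with h | h
    · subst h
      exact ⟨0, Nat.succ_pos _, by simp at hq ⊢; omega⟩
    · have hl : (0 : ℤ) < lam := by exact_mod_cast h
      have hq0 : 0 ≤ q := by
        have := hmin' x hx
        by_contra hneg
        push Not at hneg
        nlinarith
      lift q to ℕ using hq0
      refine ⟨q, ?_, by omega⟩
      have e1 := (h1 x hx).2
      have e2 := (h1 x0 hx0).1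
      have e3 : (lam : ℤ) * (D * q) ≤ lam * (n * γ) := by
        have : x = x0 + lam * q := by omega
        subst this
        rw [hab] at e1
        nlinarith
      have e4 : (D : ℤ) * q ≤ n * γ := le_of_mul_le_mul_left e3 hl
      have e5 : D * q ≤ n * γ := by exact_mod_cast e4
      have : q ≤ n * γ / D := (Nat.le_div_iff_mul_le hD).2 (by linarith)
      omega
  have h3 := Set.ncard_le_ncard hsub (Finset.finite_toSet _)
  rw [Set.ncard_coe_finset] at h3
  have h4 := h3.trans Finset.card_image_le
  rw [Finset.card_range] at h4
  have h5 := Nat.mul_le_mul_left D h4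
  have h6 := Nat.mul_div_le (n * γ) D
  rw [mul_add] at h5
  omega

lemma middle {d : ℕ} {U : Finset (Fin d → ℤ)} {P : Set (Fin d → ℝ)} {D : ℕ}
    (hD : 0 < D) (hne : U.Nonempty)
    (hU : (D : ℝ) • P = convexHull ℝ ((fun v : Fin d → ℤ => (fun i => ((v i : ℤ) : ℝ))) ''
      (U : Set (Fin d → ℤ)))) (c : Fin d → ℤ) (w : Fin d → ℤ)
    (hw : RepW U (fun i => (w i : ℝ)) 0) (γ : ℕ) :
    ∃ N : ℕ, ∀ n, N ≤ n → (∃ z : Fin d → ℤ, RepW U (fun i => (z i : ℝ)) (n / D)) →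
      ∃ t0 : ℤ, ∀ i : ℕ, i ≤ γ → t0 + (∑ j, c j * w j) * i ∈ AR c ((n : ℝ) • P) := by
  classical
  obtain ⟨β0, hβ0, hs0⟩ := hw
  obtain ⟨u0, hu0⟩ := hne
  obtain ⟨s, hs⟩ := exists_nat_ge (γ * ∑ u ∈ U, |β0 u|)
  refine ⟨D * ((s + 1) * U.card) + 1, fun n hn ⟨z, β, hβ, hsum⟩ => ?_⟩
  have hD' : (0 : ℝ) < D := by positivity
  set F : ℤ := ∑ u ∈ U, ⌊β u⌋ with hF
  have hFle : (s * U.card : ℝ) ≤ F := by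
    have h1 : ∑ u ∈ U, (β u - 1) ≤ ∑ u ∈ U, (⌊β u⌋ : ℝ) :=
      Finset.sum_le_sum fun u _ => (Int.sub_one_lt_floor _).le
    rw [Finset.sum_sub_distrib, hsum] at h1
    simp only [Finset.sum_const, nsmul_eq_mul, mul_one] at h1
    have h2 : ((s + 1) * U.card : ℝ) ≤ n / D := by
      rw [le_div_iff₀ hD']
      have : ((D * ((s + 1) * U.card) + 1 : ℕ) : ℝ) ≤ n := by exact_mod_cast hn
      push_cast at this
      linarith
    rw [hF]; push_cast
    linarith
  let k : (Fin d → ℤ) → ℤ := fun u => -⌊β u⌋ + s + if u = u0 then F - s * U.card else 0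
  have hksum : ∑ u ∈ U, (k u : ℝ) = 0 := by
    have : ∑ u ∈ U, k u = 0 := by
      simp only [k, Finset.sum_add_distrib, Finset.sum_neg_distrib, Finset.sum_ite_eq', hu0,
        if_true, Finset.sum_const, nsmul_eq_mul]
      rw [← hF]; ring
    exact_mod_cast this
  have hk : ∀ u ∈ U, (s : ℝ) ≤ β u + k u := by
    intro u _
    have h1 := Int.floor_le (β u)
    simp only [k]
    split_ifs <;> push_cast <;> linarith
  let y : Fin d → ℤ := z + ∑ u ∈ U, k u • u
  refine ⟨∑ j, c j * y j, fun i hi => ⟨fun j => y j + i * w j, ?_, ?_⟩⟩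
  · have := mem_dilate hD hU (n := n) (by omega) (fun u => β u + k u + i * β0 u) ?_ ?_
    · unfold intPts
      rw [Set.mem_setOf_eq]
      convert this using 1
      have e : (fun j => ((y j + i * w j : ℤ) : ℝ)) = (fun j => (z j : ℝ))
          + ∑ u ∈ U, (k u : ℝ) • (fun j => (u j : ℝ)) + (i : ℝ) • (fun j => (w j : ℝ)) := by
        ext j
        simp [y, Finset.sum_apply]
      rw [e, hβ, hβ0]
      simp only [add_smul, Finset.sum_add_distrib, Finset.smul_sum, mul_smul]
    · intro u hu
      have h1 := hk u hu
      have h2 : |(i : ℝ) * β0 u| ≤ s := by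
        rw [abs_mul, Nat.abs_cast]
        refine le_trans ?_ hs
        have : |β0 u| ≤ ∑ u ∈ U, |β0 u| :=
          Finset.single_le_sum (f := fun u => |β0 u|) (fun _ _ => abs_nonneg _) hu
        gcongr
      have := neg_abs_le ((i : ℝ) * β0 u)
      linarith
    · simp only [Finset.sum_add_distrib, ← Finset.mul_sum, hsum, hksum, hs0]
      ring
  · rw [Finset.sum_mul, ← Finset.sum_add_distrib]
    exact Finset.sum_congr rfl fun j _ => by ring

/-- The real linear functional of `c`. -/
noncomputable def ellc {d : ℕ} (c : Fin d → ℤ) : (Fin d → ℝ) →ₗ[ℝ] ℝ where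
  toFun x := ∑ i, (c i : ℝ) * x i
  map_add' x y := by simp [mul_add, Finset.sum_add_distrib]
  map_smul' r x := by
    simp only [Pi.smul_apply, smul_eq_mul, RingHom.id_apply, Finset.mul_sum]
    exact Finset.sum_congr rfl fun j _ => by ring

lemma ellc_int {d : ℕ} (c u : Fin d → ℤ) :
    ellc c (fun i => (u i : ℝ)) = ((∑ i, c i * u i : ℤ) : ℝ) := by
  simp [ellc]

/-- for a rational polytope `P` with denominator `D` and nonzero `c ∈ ℤ^d`,
with `m`, `M` the extreme values of `c·x` on `P`, and `λ ≥ 0` the generator of the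
subgroup `{c·w : w ∈ span(P−P) ∩ ℤ^d} ⊆ ℤ`, there is a rational `γ ≥ 0` with
`γ·λ = D·(M−m)` such that `aw_c((n+D)P) = aw_c(nP) + γ` for all large `n` whose dilate
`nP` has a lattice point in its affine span. -/
theorem aw_recurrence {d : ℕ} (P : Set (Fin d → ℝ)) (hP : IsRatPolytope P)
    (D : ℕ) (hD : IsDenom P D) (c : Fin d → ℤ) (hc : c ≠ 0)
    (m M : ℝ)
    (hm : m = sInf ((fun x : Fin d → ℝ => ∑ i, (c i : ℝ) * x i) '' P))
    (hM : M = sSup ((fun x : Fin d → ℝ => ∑ i, (c i : ℝ) * x i) '' P))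
    (lam : ℕ)
    (hlam : {j : ℤ | ∃ w : Fin d → ℤ,
        ((fun i => (w i : ℝ)) ∈ Submodule.span ℝ (P - P)) ∧ j = ∑ i, c i * w i}
      = {j : ℤ | (lam : ℤ) ∣ j}) :
    ∃ γ : ℚ, 0 ≤ γ ∧ (γ : ℝ) * (lam : ℝ) = (D : ℝ) * (M - m) ∧
      ∃ N : ℕ, ∀ n : ℕ, N ≤ n →
        (∃ z : Fin d → ℤ, (fun i => (z i : ℝ)) ∈ affineSpan ℝ ((n : ℝ) • P)) →
        (aw c (((n + D : ℕ) : ℝ) • P) : ℚ) = (aw c ((n : ℝ) • P) : ℚ) + γ := by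
  classical
  obtain ⟨hD0, ⟨U, hne, hU⟩, -⟩ := hD
  have hDr : (0 : ℝ) < D := by positivity
  obtain ⟨p, hpU, hp⟩ := U.exists_min_image (fun u => ∑ i, c i * u i) hne
  obtain ⟨q, hqU, hq⟩ := U.exists_max_image (fun u => ∑ i, c i * u i) hne
  set a : ℤ := ∑ i, c i * p i with ha
  set b : ℤ := ∑ i, c i * q i with hb
  -- vertices come from points of `P`
  have hvert : ∀ u ∈ U, ∃ x ∈ P, (D : ℝ) • x = (fun i => (u i : ℝ)) := by
    intro u hu
    have : (fun i => (u i : ℝ)) ∈ (D : ℝ) • P := by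
      rw [hU]; exact subset_convexHull ℝ _ ⟨u, hu, rfl⟩
    exact this
  have hconv : Convex ℝ P := by
    obtain ⟨V, -, rfl⟩ := hP
    exact convex_convexHull ℝ _
  have hbds : ∀ x ∈ P, (a : ℝ) ≤ D * ellc c x ∧ D * ellc c x ≤ b := by
    intro x hx
    have h1 : (D : ℝ) • x ∈ (D : ℝ) • P := Set.smul_mem_smul_set hx
    rw [hU] at h1
    have hsub : convexHull ℝ ((fun v : Fin d → ℤ => (fun i => ((v i : ℤ) : ℝ))) ''
      (U : Set (Fin d → ℤ))) ⊆ (ellc c) ⁻¹' (Set.Icc (a : ℝ) b) := by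
      apply convexHull_min
      · rintro _ ⟨u, hu, rfl⟩
        rw [Set.mem_preimage, ellc_int]
        exact ⟨by exact_mod_cast hp u hu, by exact_mod_cast hq u hu⟩
      · exact (convex_Icc _ _).linear_preimage _
    have := hsub h1
    simpa using this
  obtain ⟨p', hp'P, hp'⟩ := hvert p hpU
  obtain ⟨q', hq'P, hq'⟩ := hvert q hqU
  have hp'' : D * ellc c p' = a := by
    rw [← smul_eq_mul, ← map_smul, hp', ellc_int]
  have hq'' : D * ellc c q' = b := by
    rw [← smul_eq_mul, ← map_smul, hq', ellc_int]
  have hm' : D * m = a := by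
    have : IsLeast ((fun x : Fin d → ℝ => ∑ i, (c i : ℝ) * x i) '' P) (ellc c p') := by
      refine ⟨⟨p', hp'P, rfl⟩, ?_⟩
      rintro _ ⟨x, hx, rfl⟩
      have := (hbds x hx).1
      rw [← hp''] at this
      exact le_of_mul_le_mul_left this hDr
    rw [hm, this.csInf_eq, hp'']
  have hM' : D * M = b := by
    have : IsGreatest ((fun x : Fin d → ℝ => ∑ i, (c i : ℝ) * x i) '' P) (ellc c q') := by
      refine ⟨⟨q', hq'P, rfl⟩, ?_⟩
      rintro _ ⟨x, hx, rfl⟩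
      have := (hbds x hx).2
      rw [← hq''] at this
      exact le_of_mul_le_mul_left this hDr
    rw [hM, this.csSup_eq, hq'']
  have hle : a ≤ b := hp q hqU
  -- divisibility
  have hdiv : ∀ w : Fin d → ℤ, ((fun i => (w i : ℝ)) ∈ Submodule.span ℝ (P - P)) →
      (lam : ℤ) ∣ ∑ i, c i * w i := by
    intro w hw
    have : (∑ i, c i * w i) ∈ {j : ℤ | (lam : ℤ) ∣ j} := by
      rw [← hlam]; exact ⟨w, hw, rfl⟩
    exact this
  have hdiff : ∀ r : ℝ, ∀ x ∈ P, ∀ y ∈ P, ∀ u v : Fin d → ℤ, (fun i => (u i : ℝ)) = r • x →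
      (fun i => (v i : ℝ)) = r • y → (lam : ℤ) ∣ ∑ i, c i * u i - ∑ i, c i * v i := by
    intro r x hx y hy u v hu hv
    rw [← Finset.sum_sub_distrib]
    have := hdiv (fun i => u i - v i) ?_
    · simpa [mul_sub] using this
    · have e : (fun i => ((u i - v i : ℤ) : ℝ)) = r • (x - y) := by
        rw [smul_sub, ← hu, ← hv]; ext i; simp
      rw [e]
      exact Submodule.smul_mem _ _ (Submodule.subset_span (Set.sub_mem_sub hx hy))
  have hlab : (lam : ℤ) ∣ b - a := hdiff D q' hq'P p' hp'P q p hq'.symm hp'.symm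
  obtain ⟨γ, hγ, hγ0⟩ : ∃ γ : ℕ, b = a + lam * γ ∧ (lam = 0 → γ = 0) := by
    obtain ⟨g, hg⟩ := hlab
    rcases Nat.eq_zero_or_pos lam with h | h
    · subst h
      exact ⟨0, by simp at hg ⊢; omega, fun _ => rfl⟩
    · have hl : (0 : ℤ) < lam := by exact_mod_cast h
      have hg0 : 0 ≤ g := by
        by_contra hneg
        push Not at hneg
        nlinarith
      lift g to ℕ using hg0
      exact ⟨g, by omega, fun h' => by omega⟩
  obtain ⟨w, hw, hwl⟩ : (lam : ℤ) ∈ {j : ℤ | ∃ w : Fin d → ℤ,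
        ((fun i => (w i : ℝ)) ∈ Submodule.span ℝ (P - P)) ∧ j = ∑ i, c i * w i} := by
    rw [hlam]; exact dvd_refl _
  obtain ⟨N, hN⟩ := middle hD0 hne hU c w (RepW.of_span hD0 hU hw) γ
  -- properties of the arithmetic ranges
  have hARb : ∀ n : ℕ, ∀ x ∈ AR c ((n : ℝ) • P), n * a ≤ D * x ∧ D * x ≤ n * b := by
    rintro n _ ⟨u, ⟨x, hx, hxu⟩, rfl⟩
    have h1 := hbds x hx
    have h2 : ((∑ i, c i * u i : ℤ) : ℝ) = n * ellc c x := by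
      rw [← ellc_int, ← hxu]
      simp
    have hn : (0 : ℝ) ≤ n := by positivity
    have h3 := mul_le_mul_of_nonneg_left h1.1 hn
    have h4 := mul_le_mul_of_nonneg_left h1.2 hn
    have h5 : (n * a : ℝ) ≤ D * ((∑ i, c i * u i : ℤ) : ℝ) := by rw [h2]; linarith
    have h6 : D * ((∑ i, c i * u i : ℤ) : ℝ) ≤ (n * b : ℝ) := by rw [h2]; linarith
    exact ⟨by exact_mod_cast h5, by exact_mod_cast h6⟩
  have hARd : ∀ n : ℕ, ∀ x ∈ AR c ((n : ℝ) • P), ∀ y ∈ AR c ((n : ℝ) • P),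
      (lam : ℤ) ∣ x - y := by
    rintro n _ ⟨u, ⟨x, hx, hxu⟩, rfl⟩ _ ⟨v, ⟨y, hy, hyv⟩, rfl⟩
    exact hdiff n x hx y hy u v hxu.symm hyv.symm
  have hfin : ∀ n : ℕ, (AR c ((n : ℝ) • P)).Finite := by
    intro n
    refine (Set.finite_Icc (-|n * a|) (|n * b|)).subset fun x hx => ?_
    have h1 := hARb n x hx
    have hD1 : (1 : ℤ) ≤ D := by exact_mod_cast hD0
    have h2 := neg_abs_le (n * a)
    have h3 := le_abs_self (n * b)
    have h4 := abs_nonneg (n * a)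
    have h5 := abs_nonneg (n * b)
    constructor
    · by_contra hcon
      push Not at hcon
      nlinarith
    · by_contra hcon
      push Not at hcon
      nlinarith
  have hshift : ∀ n : ℕ, ∀ u ∈ U, ∀ x ∈ AR c ((n : ℝ) • P),
      x + ∑ i, c i * u i ∈ AR c (((n + D : ℕ) : ℝ) • P) := by
    rintro n u hu _ ⟨v, ⟨x, hx, hxv⟩, rfl⟩
    obtain ⟨u', hu'P, hu'⟩ := hvert u hu
    refine ⟨v + u, ?_, ?_⟩
    · have h1 : (fun i => (((v + u) i : ℤ) : ℝ)) = (n : ℝ) • x + (D : ℝ) • u' := by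
        rw [hu']
        simp only at hxv
        rw [hxv]; ext i; simp
      unfold intPts
      rw [Set.mem_setOf_eq, h1]
      push_cast
      rw [hconv.add_smul (by positivity) (by positivity)]
      exact Set.add_mem_add (Set.smul_mem_smul_set hx) (Set.smul_mem_smul_set hu'P)
    · simp [mul_add, Finset.sum_add_distrib]
  let good : ℕ → Prop := fun n => ∃ z : Fin d → ℤ, RepW U (fun i => (z i : ℝ)) (n / D)
  have hgood : ∀ n, good n → good (n + D) := by
    rintro n ⟨z, hz⟩
    refine ⟨z + p, ?_⟩
    have := hz.add (RepW.of_mem hpU)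
    convert this using 1
    · ext i; simp
    · push_cast
      field_simp
  obtain ⟨N', hN'⟩ := eventually_const (fun n => aw c ((n : ℝ) • P)) good D γ N hD0 hgood
    (by
      intro n hn hg
      obtain ⟨t0, ht0⟩ := hN (n + D) (by omega) (hgood n hg)
      exact card_growth _ _ (hfin n) (hfin (n + D)) a b t0 lam γ hγ hγ0
        (hshift n p hpU) (hshift n q hqU) (fun i _ hi => by rw [hwl]; exact ht0 i hi))
    (fun n => card_bound _ a b n D lam γ hD0 hγ (hfin n) (hARb n) (hARd n))
  refine ⟨γ, by positivity, ?_, N', fun n hn ⟨z, hz⟩ => ?_⟩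
  · rw [mul_sub, hm', hM', hγ]
    push_cast
    ring
  · have := hN' n hn ⟨z, RepW.of_affineSpan hD0 hU hz⟩
    exact_mod_cast this
end

section
/- Let P ⊆ ℝ^d be a rational polytope with denominator D. Then there exists an integer N such that for all integers n₁, n₂ ≥ N with n₁ ≡ n₂ (mod D), a nonzero vector c ∈ ℤ^d satisfies aw_c(n₁P) = aw(n₁P) if and only if it satisfies aw_c(n₂P) = aw(n₂P); that is, the minimum arithmetic widths of n₁P and of n₂P are attained in exactly the same set of integer directions. -/
open Pointwise

/-- A sequence that is monotone along `n ↦ n + D` stabilises. -/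
lemma stab {α : Type*} [PartialOrder α] [WellFoundedGT α] (f : ℕ → α) (D N0 : ℕ) (hD : 0 < D)
    (hf : ∀ n, N0 ≤ n → f n ≤ f (n + D)) : ∃ N, ∀ n, N ≤ n → f n = f (n + D) := by
  have key : ∀ r : ℕ, ∃ T : ℕ, ∀ t, T ≤ t → f (N0 + r + t * D) = f (N0 + r + T * D) := by
    intro r
    have hm : Monotone (fun t : ℕ => f (N0 + r + t * D)) := by
      apply monotone_nat_of_le_succ
      intro t
      have := hf (N0 + r + t * D) (by omega)
      have e : N0 + r + (t + 1) * D = N0 + r + t * D + D := by ring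
      rw [e]; exact this
    obtain ⟨T, hT⟩ := WellFoundedGT.monotone_chain_condition ⟨_, hm⟩
    exact ⟨T, fun t ht => (hT t ht).symm⟩
  choose T hT using key
  refine ⟨N0 + ((Finset.range D).sup T) * D, fun n hn => ?_⟩
  have h1 : (n - N0) % D < D := Nat.mod_lt _ hD
  have h2 : T ((n - N0) % D) ≤ (n - N0) / D := by
    refine le_trans (Finset.le_sup (f := T) (Finset.mem_range.2 h1)) ?_
    rw [Nat.le_div_iff_mul_le hD]; omega
  have h0 : N0 ≤ n := le_trans (Nat.le_add_right _ _) hn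
  have e1 : n = N0 + (n - N0) % D + ((n - N0) / D) * D := by
    have := Nat.mod_add_div' (n - N0) D
    omega
  have e2 : n + D = N0 + (n - N0) % D + ((n - N0) / D + 1) * D := by
    rw [add_mul, one_mul]; omega
  have a1 := hT ((n - N0) % D) _ h2
  have a2 := hT ((n - N0) % D) ((n - N0) / D + 1) (by omega)
  rw [← e1] at a1
  rw [← e2] at a2
  rw [a1, a2]

lemma periodic_of_step {α : Type*} (f : ℕ → α) (D N : ℕ) (h : ∀ n, N ≤ n → f n = f (n + D))
    (n₁ n₂ : ℕ) (h1 : N ≤ n₁) (h2 : N ≤ n₂) (hm : n₁ % D = n₂ % D) : f n₁ = f n₂ := by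
  have key : ∀ t n, N ≤ n → f n = f (n + t * D) := by
    intro t
    induction t with
    | zero => intro n _; simp
    | succ t ih =>
      intro n hn
      rw [ih n hn, h _ (by omega)]
      congr 1; ring
  rcases le_total n₁ n₂ with hle | hle
  · obtain ⟨t, ht⟩ := (Nat.modEq_iff_dvd' hle).1 hm
    rw [key t n₁ h1]; congr 1; rw [mul_comm] at ht; omega
  · obtain ⟨t, ht⟩ := (Nat.modEq_iff_dvd' hle).1 hm.symm
    rw [key t n₂ h2]; congr 1; rw [mul_comm] at ht; omega

/-- Comparison of two quasi-linear functions is eventually periodic. -/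
lemma compare_stab (f g : ℕ → ℕ) (D N0 k l : ℕ) (hD : 0 < D)
    (hf : ∀ n, N0 ≤ n → f (n + D) = f n + k) (hg : ∀ n, N0 ≤ n → g (n + D) = g n + l) :
    ∃ N, ∀ n, N ≤ n → (f n ≤ g n ↔ f (n + D) ≤ g (n + D)) := by
  rcases le_total k l with h | h
  · obtain ⟨N, hN⟩ := stab (fun n => (f n ≤ g n : Prop)) D N0 hD (by
      intro n hn (h' : f n ≤ g n)
      show f (n + D) ≤ g (n + D)
      rw [hf n hn, hg n hn]; omega)
    exact ⟨N, fun n hn => iff_of_eq (hN n hn)⟩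
  · obtain ⟨N, hN⟩ := stab (fun n => (g n < f n : Prop)) D N0 hD (by
      intro n hn (h' : g n < f n)
      show g (n + D) < f (n + D)
      rw [hf n hn, hg n hn]; omega)
    refine ⟨N, fun n hn => ?_⟩
    have := iff_of_eq (hN n hn)
    rw [← not_lt, ← not_lt, this]

/-- A finite integer set meeting all classes mod `k` grows by `k` under union with its shift. -/
lemma card_shift (A B : Finset ℤ) (k : ℕ) (p q : ℤ) (hk : q = p + k)
    (hA : ∀ z : ℤ, 0 < k → ∃ a ∈ A, (k : ℤ) ∣ a - z)
    (h1 : ∀ a ∈ A, a + p ∈ B) (h2 : ∀ a ∈ A, a + q ∈ B) : A.card + k ≤ B.card := by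
  classical
  rcases Nat.eq_zero_or_pos k with rfl | hkp
  · simp only [add_zero]
    exact Finset.card_le_card_of_injOn (fun a => a + p) (fun a ha => h1 a ha)
      (fun a _ b _ h => by simpa using h)
  have hmax : ∀ z : ℤ, ∃ b ∈ A, (k : ℤ) ∣ b - z ∧ b + k ∉ A := by
    intro z
    have hne : (A.filter (fun a => (k : ℤ) ∣ a - z)).Nonempty := by
      obtain ⟨a, ha, hd⟩ := hA z hkp
      exact ⟨a, Finset.mem_filter.2 ⟨ha, hd⟩⟩
    obtain ⟨b, hb, hbm⟩ := Finset.exists_max_image _ id hne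
    rw [Finset.mem_filter] at hb
    refine ⟨b, hb.1, hb.2, fun hc => ?_⟩
    have := hbm (b + k) (Finset.mem_filter.2 ⟨hc, by
      have := dvd_add hb.2 (dvd_refl (k : ℤ))
      rwa [add_sub_right_comm]⟩)
    simp only [id] at this
    omega
  choose b hbA hbd hbn using hmax
  let S : Finset ℤ := (Finset.range k).image (fun s : ℕ => b s + q)
  have hS : S.card = k := by
    rw [Finset.card_image_of_injOn, Finset.card_range]
    intro s hs t ht hst
    simp only [Finset.coe_range, Set.mem_Iio] at hs ht
    have e : b s = b t := by simpa using hst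
    have d1 := hbd s
    have d2 := hbd t
    rw [e] at d1
    have d3 := dvd_sub d1 d2
    have d4 : (k : ℤ) ∣ (t : ℤ) - s := by
      have e3 : b t - s - (b t - t) = (t : ℤ) - s := by ring
      rwa [e3] at d3
    have := Int.eq_zero_of_abs_lt_dvd d4 (by rw [abs_lt]; omega)
    omega
  let A' : Finset ℤ := A.image (fun a => a + p)
  have hA' : A'.card = A.card :=
    Finset.card_image_of_injective _ (fun a b h => by simpa using h)
  have hdis : Disjoint A' S := by
    rw [Finset.disjoint_left]
    intro x hx hx'
    simp only [A', S, Finset.mem_image] at hx hx'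
    obtain ⟨a, ha, rfl⟩ := hx
    obtain ⟨s, _, hs⟩ := hx'
    apply hbn s
    have : b s + k = a := by omega
    rwa [this]
  rw [← hA', ← hS, ← Finset.card_union_of_disjoint hdis]
  apply Finset.card_le_card
  intro x hx
  rcases Finset.mem_union.1 hx with hx | hx
  · simp only [A', Finset.mem_image] at hx
    obtain ⟨a, ha, rfl⟩ := hx
    exact h1 a ha
  · simp only [S, Finset.mem_image] at hx
    obtain ⟨s, _, rfl⟩ := hx
    exact h2 _ (hbA _)

/-- Residues modulo `M` reached from the box `[0,k]^d`. -/
lemma residues {d : ℕ} (c y : Fin d → ℤ) (hy : ∑ i, c i * y i = 1) (M : ℕ) (hM : 0 < M) (k : ℕ) :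
    ∃ S : Finset (ZMod M), min (k + 1) M ≤ S.card ∧
      ∀ s, s ∈ S ↔ ∃ x : Fin d → ℤ, (∀ i, 0 ≤ x i ∧ x i ≤ k) ∧
        ((∑ i, c i * x i : ℤ) : ZMod M) = s := by
  classical
  have : NeZero M := ⟨hM.ne'⟩
  induction k with
  | zero =>
    refine ⟨{0}, by simp, fun s => ?_⟩
    rw [Finset.mem_singleton]
    constructor
    · rintro rfl
      exact ⟨0, by simp, by simp⟩
    · rintro ⟨x, hx, rfl⟩
      have : x = 0 := by
        funext i
        have := hx i
        simp only [Nat.cast_zero] at this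
        simp only [Pi.zero_apply]; omega
      simp [this]
  | succ k ih =>
    obtain ⟨S, hS, hmem⟩ := ih
    let S' : Finset (ZMod M) := Finset.univ.filter (fun s => ∃ x : Fin d → ℤ,
      (∀ i, 0 ≤ x i ∧ x i ≤ (k + 1 : ℕ)) ∧ ((∑ i, c i * x i : ℤ) : ZMod M) = s)
    have hmem' : ∀ s, s ∈ S' ↔ ∃ x : Fin d → ℤ,
      (∀ i, 0 ≤ x i ∧ x i ≤ (k + 1 : ℕ)) ∧ ((∑ i, c i * x i : ℤ) : ZMod M) = s := by
      intro s; simp [S']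
    refine ⟨S', ?_, hmem'⟩
    have hsub : S ⊆ S' := by
      intro s hs
      obtain ⟨x, hx, he⟩ := (hmem s).1 hs
      exact (hmem' s).2 ⟨x, fun i => ⟨(hx i).1, by have := (hx i).2; push_cast; omega⟩, he⟩
    by_cases heq : S = S'
    · let T : AddSubmonoid (ZMod M) :=
        { carrier := {z | ∀ s ∈ S, s + z ∈ S}
          zero_mem' := by intro s hs; simpa using hs
          add_mem' := by
            intro a b ha hb s hs
            rw [← add_assoc]
            exact hb _ (ha _ hs) }
      have hc : ∀ j, (c j : ZMod M) ∈ T := by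
        intro j s hs
        obtain ⟨x, hx, he⟩ := (hmem s).1 hs
        rw [heq]
        refine (hmem' _).2 ⟨x + Pi.single j 1, fun i => ?_, ?_⟩
        · have := hx i
          by_cases hij : i = j
          · subst hij; simp; omega
          · simp [hij]; omega
        · rw [← he]
          simp only [Pi.add_apply, mul_add, Finset.sum_add_distrib]
          simp [Pi.single_apply]
      have hall : ∀ z : ZMod M, z ∈ S := by
        intro z
        have hz : z = ∑ j, (z * (y j : ZMod M)).val • (c j : ZMod M) := by
          have h1 : ((∑ i, c i * y i : ℤ) : ZMod M) = 1 := by rw [hy]; simp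
          push_cast at h1
          simp only [nsmul_eq_mul, ZMod.natCast_val, ZMod.cast_id', id]
          calc z = z * ∑ i, (c i : ZMod M) * (y i : ZMod M) := by rw [h1, mul_one]
            _ = _ := by rw [Finset.mul_sum]; exact Finset.sum_congr rfl (fun i _ => by ring)
        have hzT : z ∈ T := by
          rw [hz]
          exact sum_mem (fun j _ => nsmul_mem (hc j) _)
        have h0 : (0 : ZMod M) ∈ S := (hmem 0).2 ⟨0, fun i => by simp, by simp⟩
        simpa using hzT 0 h0
      have : S' = Finset.univ := by
        rw [← heq]; ext z; simp [hall z]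
      rw [this, Finset.card_univ, ZMod.card]
      exact min_le_right _ _
    · have := Finset.card_lt_card (Finset.ssubset_iff_subset_ne.2 ⟨hsub, heq⟩)
      omega

/-- many values of a primitive direction with a large coordinate on a box. -/
lemma many_values {d : ℕ} (c y : Fin d → ℤ) (hy : ∑ i, c i * y i = 1) (j : Fin d) (hj : c j ≠ 0)
    (m : ℕ) (a : Fin d → ℤ) (B : Finset ℤ)
    (hB : ∀ x : Fin d → ℤ, (∀ i, 0 ≤ x i ∧ x i ≤ 2 * (m : ℤ)) → ∑ i, c i * (a i + x i) ∈ B) :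
    (m + 1) * min (m + 1) (c j).natAbs ≤ B.card := by
  classical
  obtain ⟨S, hS, hmem⟩ := residues c y hy (c j).natAbs (Int.natAbs_pos.2 hj) m
  have : ∀ s : ZMod (c j).natAbs, ∃ x : Fin d → ℤ, s ∈ S → (∀ i, 0 ≤ x i ∧ x i ≤ m) ∧
        ((∑ i, c i * x i : ℤ) : ZMod (c j).natAbs) = s := by
    intro s
    by_cases hs : s ∈ S
    · obtain ⟨x, hx⟩ := (hmem s).1 hs
      exact ⟨x, fun _ => hx⟩
    · exact ⟨0, fun h => absurd h hs⟩
  choose X hX using this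
  calc (m + 1) * min (m + 1) (c j).natAbs ≤ (m + 1) * S.card := Nat.mul_le_mul_left _ hS
    _ = (Finset.range (m + 1) ×ˢ S).card := by simp
    _ ≤ B.card := by
      apply Finset.card_le_card_of_injOn
        (fun p : ℕ × ZMod (c j).natAbs => ∑ i, c i * (a i + (X p.2 + Pi.single j (p.1 : ℤ) : Fin d → ℤ) i))
      · rintro ⟨t, s⟩ hp
        simp only [Finset.coe_product, Set.mem_prod, Finset.mem_coe, Finset.mem_range] at hp
        apply hB
        intro i
        have := (hX s hp.2).1 i
        by_cases hij : i = j
        · subst hij; simp; omega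
        · simp [hij]; omega
      · rintro ⟨t, s⟩ hp ⟨t', s'⟩ hp' heq
        simp only [Finset.coe_product, Set.mem_prod, Finset.mem_coe, Finset.mem_range] at hp hp'
        have h1 := (hX s hp.2).2
        have h2 := (hX s' hp'.2).2
        simp only [Pi.add_apply, mul_add, Finset.sum_add_distrib, add_right_inj] at heq
        simp only [Pi.single_apply, mul_ite, mul_zero, Finset.sum_ite_eq', Finset.mem_univ,
          if_true] at heq
        have hz : ((c j : ℤ) : ZMod (c j).natAbs) = 0 := by
          rw [ZMod.intCast_zmod_eq_zero_iff_dvd]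
          exact Int.natAbs_dvd.2 (dvd_refl _)
        have h3 : s = s' := by
          rw [← h1, ← h2]
          have := congrArg (fun z : ℤ => (z : ZMod (c j).natAbs)) heq
          simpa [hz] using this
        subst h3
        have h4 : c j * (t : ℤ) = c j * t' := by linarith
        have h5 := mul_left_cancel₀ hj h4
        simp only [Prod.mk.injEq, and_true]
        exact_mod_cast h5

lemma pts_add {d : ℕ} {P : Set (Fin d → ℝ)} (hP : Convex ℝ P) {D : ℕ} {U : Finset (Fin d → ℤ)}
    (hU : (D : ℝ) • P = convexHull ℝ
      ((fun v : Fin d → ℤ => (fun i => ((v i : ℤ) : ℝ))) '' (U : Set (Fin d → ℤ))))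
    {n : ℕ} {x u : Fin d → ℤ} (hx : x ∈ intPts ((n : ℝ) • P)) (hu : u ∈ U) :
    x + u ∈ intPts (((n + D : ℕ) : ℝ) • P) := by
  have h1 : (fun i => (u i : ℝ)) ∈ (D : ℝ) • P := by
    rw [hU]; exact subset_convexHull _ _ ⟨u, hu, rfl⟩
  have h2 : (fun i => (x i : ℝ)) ∈ (n : ℝ) • P := hx
  show (fun i => (((x + u) i : ℤ) : ℝ)) ∈ ((n + D : ℕ) : ℝ) • P
  rw [Nat.cast_add, hP.add_smul (Nat.cast_nonneg n) (Nat.cast_nonneg D)]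
  refine Set.mem_add.2 ⟨_, h2, _, h1, ?_⟩
  funext i; simp

lemma val_bound {d : ℕ} {P : Set (Fin d → ℝ)} {D : ℕ} {U : Finset (Fin d → ℤ)}
    (hU : (D : ℝ) • P = convexHull ℝ
      ((fun v : Fin d → ℤ => (fun i => ((v i : ℤ) : ℝ))) '' (U : Set (Fin d → ℤ))))
    {n : ℕ} {x : Fin d → ℤ} (hx : x ∈ intPts ((n : ℝ) • P)) (c : Fin d → ℤ) (h : ℤ)
    (hc : ∀ u ∈ U, ∑ i, c i * u i ≤ h) : (D : ℤ) * ∑ i, c i * x i ≤ n * h := by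
  obtain ⟨p, hp, hpx⟩ := Set.mem_smul_set.1 (show (fun i => (x i : ℝ)) ∈ (n : ℝ) • P from hx)
  have hDp : (D : ℝ) • p ∈ (D : ℝ) • P := Set.smul_mem_smul_set hp
  have hconv : Convex ℝ {z : Fin d → ℝ | ∑ i, (c i : ℝ) * z i ≤ h} := by
    apply convex_halfSpace_le
    constructor
    · intro a b; simp [mul_add, Finset.sum_add_distrib]
    · intro t a; simp only [Pi.smul_apply, smul_eq_mul, Finset.mul_sum]
      exact Finset.sum_congr rfl (fun i _ => by ring)
  have hsub : (D : ℝ) • p ∈ {z : Fin d → ℝ | ∑ i, (c i : ℝ) * z i ≤ h} := by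
    rw [hU] at hDp
    refine convexHull_min ?_ hconv hDp
    rintro _ ⟨u, hu, rfl⟩
    have := hc u hu
    show ∑ i, (c i : ℝ) * (u i : ℝ) ≤ h
    exact_mod_cast this
  have h1 : ∑ i, (c i : ℝ) * ((D : ℝ) * p i) ≤ h := hsub
  have h2 : ∀ i, (x i : ℝ) = n * p i := fun i => (congrFun hpx i).symm
  have h3 : (D : ℝ) * ∑ i, (c i : ℝ) * (x i : ℝ) ≤ n * h := by
    calc (D : ℝ) * ∑ i, (c i : ℝ) * (x i : ℝ) = n * ∑ i, (c i : ℝ) * ((D : ℝ) * p i) := by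
          simp only [h2, Finset.mul_sum]
          exact Finset.sum_congr rfl (fun i _ => by ring)
      _ ≤ n * h := by gcongr
  exact_mod_cast h3

lemma val_bound' {d : ℕ} {P : Set (Fin d → ℝ)} {D : ℕ} {U : Finset (Fin d → ℤ)}
    (hU : (D : ℝ) • P = convexHull ℝ
      ((fun v : Fin d → ℤ => (fun i => ((v i : ℤ) : ℝ))) '' (U : Set (Fin d → ℤ))))
    {n : ℕ} {x : Fin d → ℤ} (hx : x ∈ intPts ((n : ℝ) • P)) (c : Fin d → ℤ) (h : ℤ)
    (hc : ∀ u ∈ U, h ≤ ∑ i, c i * u i) : n * h ≤ (D : ℤ) * ∑ i, c i * x i := by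
  have := val_bound hU hx (-c) (-h) (fun u hu => by
    have := hc u hu
    simp only [Pi.neg_apply, neg_mul, Finset.sum_neg_distrib]; omega)
  simp only [Pi.neg_apply, neg_mul, Finset.sum_neg_distrib, mul_neg] at this
  linarith

lemma AR_finite {d : ℕ} {P : Set (Fin d → ℝ)} {D : ℕ} (hD : 0 < D) {U : Finset (Fin d → ℤ)}
    (hU0 : U.Nonempty)
    (hU : (D : ℝ) • P = convexHull ℝ
      ((fun v : Fin d → ℤ => (fun i => ((v i : ℤ) : ℝ))) '' (U : Set (Fin d → ℤ))))
    (n : ℕ) (c : Fin d → ℤ) : (AR c ((n : ℝ) • P)).Finite := by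
  obtain ⟨u, hu, hmax⟩ := Finset.exists_max_image U (fun u => ∑ i, c i * u i) hU0
  obtain ⟨v, hv, hmin⟩ := Finset.exists_min_image U (fun u => ∑ i, c i * u i) hU0
  apply (Set.finite_Icc (-|(n : ℤ) * ∑ i, c i * v i|) (|(n : ℤ) * ∑ i, c i * u i|)).subset
  rintro z ⟨x, hx, rfl⟩
  have h1 := val_bound hU hx c _ hmax
  have h2 := val_bound' hU hx c _ hmin
  have h3 := le_abs_self ((n : ℤ) * ∑ i, c i * u i)
  have h4 := neg_abs_le ((n : ℤ) * ∑ i, c i * v i)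
  have h5 := abs_nonneg ((n : ℤ) * ∑ i, c i * u i)
  have h6 := abs_nonneg ((n : ℤ) * ∑ i, c i * v i)
  have hD' : (1 : ℤ) ≤ D := by exact_mod_cast hD
  constructor
  · by_contra hlt
    push Not at hlt
    nlinarith
  · by_contra hlt
    push Not at hlt
    nlinarith

/-- Upper bound for the arithmetic width. -/
lemma aw_upper {d : ℕ} {P : Set (Fin d → ℝ)} {D : ℕ} (hD : 0 < D) {U : Finset (Fin d → ℤ)}
    (hU0 : U.Nonempty)
    (hU : (D : ℝ) • P = convexHull ℝ
      ((fun v : Fin d → ℤ => (fun i => ((v i : ℤ) : ℝ))) '' (U : Set (Fin d → ℤ))))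
    (n : ℕ) (c : Fin d → ℤ) (h l : ℤ) (k : ℕ) (hk : h = l + k)
    (hmax : ∀ u ∈ U, ∑ i, c i * u i ≤ h) (hmin : ∀ u ∈ U, l ≤ ∑ i, c i * u i) :
    D * aw c ((n : ℝ) • P) ≤ n * k + D := by
  have hfin := AR_finite hD hU0 hU n c
  unfold aw
  rw [Set.ncard_eq_toFinset_card _ hfin]
  rcases hfin.toFinset.eq_empty_or_nonempty with he | hne
  · rw [he]; simp
  have b1 := Finset.max'_mem _ hne
  have b2 := Finset.min'_mem _ hne
  have hsub : hfin.toFinset ⊆ Finset.Icc (hfin.toFinset.min' hne) (hfin.toFinset.max' hne) :=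
    fun z hz => Finset.mem_Icc.2 ⟨Finset.min'_le _ _ hz, Finset.le_max' _ _ hz⟩
  have hcard := Finset.card_le_card hsub
  rw [Int.card_Icc] at hcard
  have hle := Finset.min'_le _ _ b1
  generalize hfin.toFinset.max' hne = mx at *
  generalize hfin.toFinset.min' hne = mn at *
  rw [Set.Finite.mem_toFinset] at b1 b2
  obtain ⟨x, hx, rfl⟩ := b1
  obtain ⟨y, hy, rfl⟩ := b2
  have e1 := val_bound hU hx c _ hmax
  have e2 := val_bound' hU hy c _ hmin
  have e3 : (hfin.toFinset.card : ℤ) ≤ ∑ i, c i * x i + 1 - ∑ i, c i * y i := by omega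
  have e4 := mul_le_mul_of_nonneg_left e3 (Int.natCast_nonneg D)
  subst hk
  have e5 : (D : ℤ) * hfin.toFinset.card ≤ n * k + D := by nlinarith
  exact_mod_cast e5

/-- Boxes in dilates of a convex set with interior. -/
lemma boxes {d : ℕ} {P : Set (Fin d → ℝ)} (hint : (interior P).Nonempty) :
    ∃ q : ℕ, 0 < q ∧ ∃ N : ℕ, ∀ n, N ≤ n → ∃ a : Fin d → ℤ, ∀ x : Fin d → ℤ,
      (∀ i, 0 ≤ x i ∧ x i ≤ 2 * ((n / q : ℕ) : ℤ)) → (a + x) ∈ intPts ((n : ℝ) • P) := by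
  obtain ⟨p, hp⟩ := hint
  obtain ⟨r, hr, hball⟩ := Metric.nhds_basis_closedBall.mem_iff.1 (mem_interior_iff_mem_nhds.1 hp)
  obtain ⟨q, hq⟩ := exists_nat_gt (4 / r)
  obtain ⟨N, hN⟩ := exists_nat_gt (2 / r)
  have hq0 : (0 : ℝ) < q := lt_trans (by positivity) hq
  refine ⟨q, by exact_mod_cast hq0, N + 1, fun n hn => ⟨fun i => ⌈(n : ℝ) * p i⌉, fun x hx => ?_⟩⟩
  have hn0 : (0 : ℝ) < n := by exact_mod_cast (show 0 < n by omega)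
  have hnN : (N : ℝ) ≤ n := by exact_mod_cast (show N ≤ n by omega)
  show (fun i => ((((fun i => ⌈(n : ℝ) * p i⌉) + x) i : ℤ) : ℝ)) ∈ (n : ℝ) • P
  rw [Set.mem_smul_set_iff_inv_smul_mem₀ hn0.ne']
  apply hball
  rw [Metric.mem_closedBall, dist_pi_le_iff hr.le]
  intro i
  have h1 : (((n / q : ℕ) : ℝ)) ≤ n / q := Nat.cast_div_le
  have h2 : (n : ℝ) / q ≤ n * (r / 4) := by
    rw [div_eq_mul_inv]
    gcongr
    rw [inv_le_comm₀ hq0 (by positivity), inv_div]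
    exact hq.le
  have h3 : 1 ≤ n * (r / 2) := by
    rw [div_lt_iff₀ hr] at hN
    nlinarith
  have h4 : (0 : ℝ) ≤ x i := by exact_mod_cast (hx i).1
  have h5 : (x i : ℝ) ≤ 2 * ((n / q : ℕ) : ℝ) := by
    have h := (hx i).2
    have h' : ((x i : ℤ) : ℝ) ≤ ((2 * ((n / q : ℕ) : ℤ) : ℤ) : ℝ) := Int.cast_le.2 h
    rwa [Int.cast_mul, Int.cast_natCast, Int.cast_ofNat] at h'
  have h6 := Int.le_ceil ((n : ℝ) * p i)
  have h7 := Int.ceil_lt_add_one ((n : ℝ) * p i)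
  rw [Real.dist_eq]
  simp only [Pi.smul_apply, Pi.add_apply, smul_eq_mul]
  push_cast
  have e : (n : ℝ)⁻¹ * (⌈(n : ℝ) * p i⌉ + x i) - p i
      = (⌈(n : ℝ) * p i⌉ + x i - n * p i) / n := by field_simp
  rw [e, abs_div, abs_of_pos hn0, div_le_iff₀ hn0, abs_le]
  constructor <;> nlinarith

/-- Without interior there is an integer direction of arithmetic width at most one. -/
lemma flat_direction {d : ℕ} {P : Set (Fin d → ℝ)} (hP : IsRatPolytope P)
    (hint : ¬ (interior P).Nonempty) :
    ∃ c : Fin d → ℤ, c ≠ 0 ∧ ∃ t : ℝ, ∀ p ∈ P, ∑ i, (c i : ℝ) * p i = t := by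
  classical
  obtain ⟨V, ⟨v0, hv0⟩, rfl⟩ := hP
  let e : (Fin d → ℚ) →ₗ[ℚ] (Fin d → ℝ) :=
    { toFun := fun v i => (v i : ℝ)
      map_add' := by intro a b; funext i; simp
      map_smul' := by intro a b; funext i; simp [Rat.smul_def] }
  rw [interior_convexHull_nonempty_iff_affineSpan_eq_top] at hint
  let W : Submodule ℚ (Fin d → ℚ) := Submodule.span ℚ ((fun v => v - v0) '' (V : Set (Fin d → ℚ)))
  have hW : W ≠ ⊤ := by
    intro htop
    apply hint
    have hv0' : e v0 ∈ affineSpan ℝ (e '' (V : Set (Fin d → ℚ))) :=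
      subset_affineSpan _ _ ⟨v0, hv0, rfl⟩
    show affineSpan ℝ (e '' (V : Set (Fin d → ℚ))) = ⊤
    rw [← AffineSubspace.direction_eq_top_iff_of_nonempty ⟨_, hv0'⟩, direction_affineSpan]
    have hle : W ≤ ((vectorSpan ℝ (e '' (V : Set (Fin d → ℚ)))).restrictScalars ℚ).comap e := by
      rw [Submodule.span_le]
      rintro _ ⟨v, hv, rfl⟩
      show e (v - v0) ∈ vectorSpan ℝ (e '' (V : Set (Fin d → ℚ)))
      rw [map_sub]
      exact vsub_mem_vectorSpan ℝ ⟨v, hv, rfl⟩ ⟨v0, hv0, rfl⟩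
    rw [htop] at hle
    rw [eq_top_iff, ← (Pi.basisFun ℝ (Fin d)).span_eq, Submodule.span_le]
    rintro _ ⟨i, rfl⟩
    have h1 : e (Pi.single i 1) ∈ vectorSpan ℝ (e '' (V : Set (Fin d → ℚ))) :=
      hle (Submodule.mem_top (x := Pi.single i 1))
    have h2 : (Pi.basisFun ℝ (Fin d)) i = e (Pi.single i 1) := ?_
    · rw [h2]; exact h1
    funext j
    show (Pi.basisFun ℝ (Fin d)) i j = (((Pi.single i 1 : Fin d → ℚ) j : ℚ) : ℝ)
    rw [Pi.basisFun_apply]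
    by_cases hij : j = i
    · subst hij; simp
    · simp [hij]
  obtain ⟨f, hf0, hf⟩ := Submodule.exists_le_ker_of_lt_top W (lt_top_iff_ne_top.2 hW)
  -- clear denominators
  let b : Fin d → ℚ := fun i => f (Pi.single i 1)
  let M : ℕ := ∏ i, (b i).den
  have hM : M ≠ 0 := Finset.prod_ne_zero_iff.2 (fun i _ => (b i).den_nz)
  have hint' : ∀ i, ∃ z : ℤ, (z : ℚ) = M * b i := by
    intro i
    obtain ⟨s, hs⟩ : (b i).den ∣ M := Finset.dvd_prod_of_mem _ (Finset.mem_univ i)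
    refine ⟨s * (b i).num, ?_⟩
    rw [hs]
    have := Rat.den_mul_eq_num (b i)
    push_cast
    rw [← this]; ring
  choose c hc using hint'
  have hfe : ∀ v : Fin d → ℚ, f v = ∑ i, b i * v i := by
    intro v
    conv_lhs => rw [pi_eq_sum_univ' v]
    rw [map_sum]
    refine Finset.sum_congr rfl (fun i _ => ?_)
    rw [map_smul, smul_eq_mul, mul_comm]
  refine ⟨c, ?_, ∑ i, (c i : ℝ) * e v0 i, ?_⟩
  · rintro rfl
    apply hf0
    apply LinearMap.ext
    intro v
    rw [hfe]
    simp only [LinearMap.zero_apply]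
    refine Finset.sum_eq_zero (fun i _ => ?_)
    have := hc i
    have hb : b i = 0 := by
      simp only [Pi.zero_apply, Int.cast_zero] at this
      rcases mul_eq_zero.1 this.symm with h | h
      · exact absurd (by exact_mod_cast h) hM
      · exact h
    rw [hb, zero_mul]
  · have hconv : Convex ℝ {z : Fin d → ℝ | ∑ i, (c i : ℝ) * z i = ∑ i, (c i : ℝ) * e v0 i} := by
      apply convex_hyperplane
      constructor
      · intro a b; simp [mul_add, Finset.sum_add_distrib]
      · intro t a; simp only [Pi.smul_apply, smul_eq_mul, Finset.mul_sum]
        exact Finset.sum_congr rfl (fun i _ => by ring)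
    refine fun p hp => convexHull_min ?_ hconv hp
    rintro _ ⟨v, hv, rfl⟩
    show ∑ i, (c i : ℝ) * ((v i : ℚ) : ℝ) = ∑ i, (c i : ℝ) * ((v0 i : ℚ) : ℝ)
    have h1 : f (v - v0) = 0 := hf (Submodule.subset_span ⟨v, hv, rfl⟩)
    rw [map_sub, hfe, hfe, sub_eq_zero] at h1
    have h2 : ∑ i, (c i : ℚ) * v i = ∑ i, (c i : ℚ) * v0 i := by
      simp only [hc, mul_assoc, ← Finset.mul_sum]
      rw [h1]
    exact_mod_cast h2

lemma opt_iff {d : ℕ} (K : Set (Fin d → ℝ)) (c : Fin d → ℤ) (hc : c ≠ 0) :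
    aw c K = awMin K ↔ ∀ b : Fin d → ℤ, b ≠ 0 → aw c K ≤ aw b K := by
  have hle : ∀ b : Fin d → ℤ, b ≠ 0 → awMin K ≤ aw b K := fun b hb => Nat.sInf_le ⟨b, hb, rfl⟩
  constructor
  · intro h b hb
    rw [h]; exact hle b hb
  · intro h
    obtain ⟨b, hb, he⟩ := Nat.sInf_mem (s := {m : ℕ | ∃ c : Fin d → ℤ, c ≠ 0 ∧ m = aw c K})
      ⟨_, c, hc, rfl⟩
    apply le_antisymm _ (hle c hc)
    unfold awMin
    rw [he]; exact h b hb

lemma exists_prim {d : ℕ} (c : Fin d → ℤ) (hc : c ≠ 0) :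
    ∃ c' y : Fin d → ℤ, ∑ i, c' i * y i = 1 ∧ ∃ g : ℤ, g ≠ 0 ∧ c = g • c' := by
  obtain ⟨g, hg⟩ := (IsPrincipalIdealRing.principal (Ideal.span (Set.range c))).principal
  have h1 : ∀ i, g ∣ c i := by
    intro i
    have : c i ∈ Ideal.span (Set.range c) := Ideal.subset_span ⟨i, rfl⟩
    rw [hg] at this
    exact Ideal.mem_span_singleton.1 this
  have h2 : g ∈ Ideal.span (Set.range c) := by
    rw [hg]; exact Submodule.mem_span_singleton_self g
  obtain ⟨y, hy⟩ := Ideal.mem_span_range_iff_exists_fun.1 h2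
  choose c' hc' using h1
  have hg0 : g ≠ 0 := by
    rintro rfl
    apply hc
    funext i
    simpa using hc' i
  refine ⟨c', y, ?_, g, hg0, ?_⟩
  · apply mul_left_cancel₀ hg0
    rw [mul_one, Finset.mul_sum]
    conv_rhs => rw [← hy]
    refine Finset.sum_congr rfl (fun i _ => ?_)
    rw [hc' i]; ring
  · funext i; simp [hc' i]

lemma aw_smul_s5 {d : ℕ} (K : Set (Fin d → ℝ)) (c : Fin d → ℤ) (g : ℤ) (hg : g ≠ 0) :
    aw (g • c) K = aw c K := by
  unfold aw
  have : AR (g • c) K = (fun z => g * z) '' AR c K := by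
    ext z
    constructor
    · rintro ⟨x, hx, rfl⟩
      refine ⟨_, ⟨x, hx, rfl⟩, ?_⟩
      simp [Finset.mul_sum, mul_assoc]
    · rintro ⟨_, ⟨x, hx, rfl⟩, rfl⟩
      refine ⟨x, hx, ?_⟩
      simp [Finset.mul_sum, mul_assoc]
  rw [this, Set.ncard_image_of_injective _ (mul_right_injective₀ hg)]

lemma convex_of_rat {d : ℕ} {P : Set (Fin d → ℝ)} (hP : IsRatPolytope P) : Convex ℝ P := by
  obtain ⟨V, _, rfl⟩ := hP
  exact convex_convexHull _ _

/-- Eventual quasi-linearity for primitive directions. -/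
lemma quasi_linear {d : ℕ} {P : Set (Fin d → ℝ)} (hP : Convex ℝ P) (hint : (interior P).Nonempty)
    {D : ℕ} (hD : 0 < D) {U : Finset (Fin d → ℤ)} (hU0 : U.Nonempty)
    (hU : (D : ℝ) • P = convexHull ℝ
      ((fun v : Fin d → ℤ => (fun i => ((v i : ℤ) : ℝ))) '' (U : Set (Fin d → ℤ))))
    (c y : Fin d → ℤ) (hy : ∑ i, c i * y i = 1) :
    ∃ k N : ℕ, ∀ n, N ≤ n →
      aw c (((n + D : ℕ) : ℝ) • P) = aw c ((n : ℝ) • P) + k := by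
  obtain ⟨u, hu, hmax⟩ := Finset.exists_max_image U (fun u => ∑ i, c i * u i) hU0
  obtain ⟨v, hv, hmin⟩ := Finset.exists_min_image U (fun u => ∑ i, c i * u i) hU0
  obtain ⟨k, hk⟩ : ∃ k : ℕ, ∑ i, c i * u i = ∑ i, c i * v i + k := by
    obtain ⟨k, hk⟩ := Int.eq_ofNat_of_zero_le (sub_nonneg.2 (hmin u hu))
    exact ⟨k, by linarith⟩
  obtain ⟨q, hq, N0, hbox⟩ := boxes hint
  have hstep : ∀ n, max N0 (q * k) ≤ n →
      aw c ((n : ℝ) • P) + k ≤ aw c (((n + D : ℕ) : ℝ) • P) := by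
    intro n hn
    have hf1 := AR_finite hD hU0 hU n c
    have hf2 := AR_finite hD hU0 hU (n + D) c
    unfold aw
    rw [Set.ncard_eq_toFinset_card _ hf1, Set.ncard_eq_toFinset_card _ hf2]
    have hadd : ∀ w ∈ U, ∀ a ∈ hf1.toFinset, a + ∑ i, c i * w i ∈ hf2.toFinset := by
      intro w hw a ha
      rw [Set.Finite.mem_toFinset] at ha ⊢
      obtain ⟨x, hx, rfl⟩ := ha
      refine ⟨x + w, pts_add hP hU hx hw, ?_⟩
      simp [mul_add, Finset.sum_add_distrib]
    refine card_shift _ _ k _ _ hk ?_ (hadd v hv) (hadd u hu)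
    intro z hk0
    obtain ⟨a, ha⟩ := hbox n (le_trans (le_max_left _ _) hn)
    have hkn : k ≤ n / q := by
      rw [Nat.le_div_iff_mul_le hq, mul_comm]; exact le_trans (le_max_right _ _) hn
    have hk0' : (0 : ℤ) < k := by exact_mod_cast hk0
    let s : ℤ := z - ∑ i, c i * a i
    let x : Fin d → ℤ := fun i => (s * y i) % k
    have hx := ha x (fun i => ⟨Int.emod_nonneg _ hk0'.ne', by
      have := Int.emod_lt_of_pos (s * y i) hk0'
      simp only [x]
      have : (k : ℤ) ≤ (n / q : ℕ) := by exact_mod_cast hkn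
      omega⟩)
    refine ⟨∑ i, c i * (a + x) i, ?_, ?_⟩
    · rw [Set.Finite.mem_toFinset]; exact ⟨_, hx, rfl⟩
    · have e1 : ∑ i, c i * (a + x) i - z = ∑ i, c i * x i - s * ∑ i, c i * y i := by
        rw [hy]
        simp only [Pi.add_apply, mul_add, Finset.sum_add_distrib, s]; ring
      rw [e1, Finset.mul_sum, ← Finset.sum_sub_distrib]
      refine Finset.dvd_sum (fun i _ => ?_)
      have e2 : c i * x i - s * (c i * y i) = c i * ((s * y i) % k - s * y i) := by
        simp only [x]; ring
      rw [e2]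
      refine Dvd.dvd.mul_left ?_ _
      rw [← Int.neg_sub]
      exact (Int.dvd_neg).2 (Int.dvd_self_sub_emod)
  have hup : ∀ n : ℕ, D * aw c ((n : ℝ) • P) ≤ n * k + D := fun n =>
    aw_upper hD hU0 hU n c _ _ k hk hmax hmin
  obtain ⟨N, hN⟩ := stab (α := ℕᵒᵈ)
    (fun n => OrderDual.toDual (n * k + D - D * aw c ((n : ℝ) • P))) D (max N0 (q * k)) hD (by
      intro n hn
      rw [OrderDual.toDual_le_toDual]
      have h1 := Nat.mul_le_mul_left D (hstep n hn)
      rw [mul_add] at h1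
      rw [add_mul]
      omega)
  refine ⟨k, N, fun n hn => ?_⟩
  have h1 := OrderDual.toDual_inj.1 (hN n hn)
  have h2 := hup n
  have h3 := hup (n + D)
  apply Nat.eq_of_mul_eq_mul_left hD
  rw [mul_add]
  rw [add_mul] at h1 h3
  omega

lemma full_dim_case {d : ℕ} {P : Set (Fin d → ℝ)} (hP : Convex ℝ P)
    (hint : (interior P).Nonempty)
    {D : ℕ} (hD : 0 < D) {U : Finset (Fin d → ℤ)} (hU0 : U.Nonempty)
    (hU : (D : ℝ) • P = convexHull ℝ
      ((fun v : Fin d → ℤ => (fun i => ((v i : ℤ) : ℝ))) '' (U : Set (Fin d → ℤ)))) :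
    ∃ N : ℕ, ∀ n, N ≤ n → ∀ c : Fin d → ℤ, c ≠ 0 →
      (aw c ((n : ℝ) • P) = awMin ((n : ℝ) • P) ↔
        aw c (((n + D : ℕ) : ℝ) • P) = awMin (((n + D : ℕ) : ℝ) • P)) := by
  classical
  by_cases hd : ∃ c0 : Fin d → ℤ, c0 ≠ 0
  swap
  · exact ⟨0, fun n _ c hc => absurd ⟨c, hc⟩ hd⟩
  obtain ⟨c0, hc0⟩ := hd
  obtain ⟨u, hu, hmax⟩ := Finset.exists_max_image U (fun u => ∑ i, c0 i * u i) hU0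
  obtain ⟨v, hv, hmin⟩ := Finset.exists_min_image U (fun u => ∑ i, c0 i * u i) hU0
  obtain ⟨k, hk⟩ : ∃ k : ℕ, ∑ i, c0 i * u i = ∑ i, c0 i * v i + k := by
    obtain ⟨k, hk⟩ := Int.eq_ofNat_of_zero_le (sub_nonneg.2 (hmin u hu))
    exact ⟨k, by linarith⟩
  obtain ⟨q, hq, N0, hbox⟩ := boxes hint
  let M : ℕ := q * (k + D)
  have hMpos : 0 < M := by positivity
  -- directions with a large coordinate are never optimal
  have hlarge : ∀ n, N0 + q * M + 1 ≤ n → ∀ c y : Fin d → ℤ, ∑ i, c i * y i = 1 →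
      ∀ j, M < (c j).natAbs → aw c0 ((n : ℝ) • P) < aw c ((n : ℝ) • P) := by
    intro n hn c y hy j hj
    have hcj : c j ≠ 0 := by
      intro h; rw [h] at hj; simp at hj
    obtain ⟨a, ha⟩ := hbox n (by omega)
    have hfin := AR_finite hD hU0 hU n c
    have hmany := many_values c y hy j hcj (n / q) a hfin.toFinset (by
      intro x hx
      rw [Set.Finite.mem_toFinset]
      exact ⟨a + x, ha x hx, rfl⟩)
    rw [← Set.ncard_eq_toFinset_card _ hfin] at hmany
    change _ ≤ aw c ((n : ℝ) • P) at hmany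
    have hup := aw_upper hD hU0 hU n c0 _ _ k hk hmax hmin
    have h1 : M ≤ n / q := by
      rw [Nat.le_div_iff_mul_le hq, mul_comm]; omega
    have h2 : M ≤ min (n / q + 1) (c j).natAbs := by
      rw [le_min_iff]; omega
    have h3 : n < (n / q + 1) * q := by
      rw [mul_comm]; exact Nat.lt_mul_div_succ n hq
    have h4 : (n / q + 1) * M ≤ aw c ((n : ℝ) • P) :=
      le_trans (Nat.mul_le_mul_left _ h2) hmany
    have h5 : n * (k + D) < (n / q + 1) * M := by
      simp only [M]
      rw [← mul_assoc]
      exact Nat.mul_lt_mul_of_pos_right h3 (by omega)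
    have h6 : n * k + D ≤ n * (k + D) := by
      rw [mul_add]
      have : D ≤ n * D := Nat.le_mul_of_pos_left _ (by omega)
      omega
    have h7 : aw c0 ((n : ℝ) • P) ≤ D * aw c0 ((n : ℝ) • P) := Nat.le_mul_of_pos_left _ hD
    omega
  let F : Finset (Fin d → ℤ) := (Fintype.piFinset (fun _ => Finset.Icc (-(M : ℤ)) M)).filter
    (fun c => ∃ y : Fin d → ℤ, ∑ i, c i * y i = 1)
  have hF : ∀ c, c ∈ F → ∃ y : Fin d → ℤ, ∑ i, c i * y i = 1 := fun c hc =>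
    (Finset.mem_filter.1 hc).2
  have hF0 : ∀ c, c ∈ F → c ≠ 0 := by
    rintro c hc rfl
    obtain ⟨y, hy⟩ := hF _ hc
    simp at hy
  have hF' : ∀ c y : Fin d → ℤ, ∑ i, c i * y i = 1 → c ∉ F → ∃ j, M < (c j).natAbs := by
    intro c y hy hc
    by_contra hcon
    push Not at hcon
    apply hc
    refine Finset.mem_filter.2 ⟨Fintype.mem_piFinset.2 (fun i => ?_), y, hy⟩
    have := hcon i
    rw [Finset.mem_Icc]; omega
  have hcmp : ∀ b c : Fin d → ℤ, ∃ N : ℕ, b ∈ F → c ∈ F → ∀ n, N ≤ n →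
      (aw b ((n : ℝ) • P) ≤ aw c ((n : ℝ) • P) ↔
        aw b (((n + D : ℕ) : ℝ) • P) ≤ aw c (((n + D : ℕ) : ℝ) • P)) := by
    intro b c
    by_cases hb : b ∈ F
    · by_cases hc : c ∈ F
      · obtain ⟨y, hy⟩ := hF b hb
        obtain ⟨z, hz⟩ := hF c hc
        obtain ⟨k1, N1, h1⟩ := quasi_linear hP hint hD hU0 hU b y hy
        obtain ⟨k2, N2, h2⟩ := quasi_linear hP hint hD hU0 hU c z hz
        obtain ⟨N, hN⟩ := compare_stab (fun n => aw b ((n : ℝ) • P)) (fun n => aw c ((n : ℝ) • P))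
          D (max N1 N2) k1 k2 hD (fun n hn => h1 n (le_trans (le_max_left _ _) hn))
          (fun n hn => h2 n (le_trans (le_max_right _ _) hn))
        exact ⟨N, fun _ _ => hN⟩
      · exact ⟨0, fun _ h => absurd h hc⟩
    · exact ⟨0, fun h => absurd h hb⟩
  choose NN hNN using hcmp
  have hopt : ∀ n, N0 + q * M + 1 ≤ n → ∀ c y : Fin d → ℤ, ∑ i, c i * y i = 1 →
      ((∀ b : Fin d → ℤ, b ≠ 0 → aw c ((n : ℝ) • P) ≤ aw b ((n : ℝ) • P)) ↔
        (c ∈ F ∧ ∀ b ∈ F, aw c ((n : ℝ) • P) ≤ aw b ((n : ℝ) • P))) := by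
    intro n hn c y hy
    constructor
    · intro h
      refine ⟨?_, fun b hb => h b (hF0 b hb)⟩
      by_contra hc
      obtain ⟨j, hj⟩ := hF' c y hy hc
      have h1 := hlarge n hn c y hy j hj
      have h2 := h c0 hc0
      omega
    · rintro ⟨hc, h⟩
      -- the primitive part of `c0` bounds everything outside `F`
      have hprim : ∀ b z : Fin d → ℤ, ∑ i, b i * z i = 1 →
          b ∈ F ∨ aw c0 ((n : ℝ) • P) < aw b ((n : ℝ) • P) := by
        intro b z hz
        by_cases hb : b ∈ F
        · exact Or.inl hb
        · obtain ⟨j, hj⟩ := hF' b z hz hb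
          exact Or.inr (hlarge n hn b z hz j hj)
      have h0 : aw c ((n : ℝ) • P) ≤ aw c0 ((n : ℝ) • P) := by
        obtain ⟨b, z, hz, g, hg, he⟩ := exists_prim c0 hc0
        have hs := aw_smul_s5 ((n : ℝ) • P) b g hg
        rw [← he] at hs
        rcases hprim b z hz with hb | hb
        · rw [hs]; exact h b hb
        · omega
      intro b' hb'
      obtain ⟨b, z, hz, g, hg, rfl⟩ := exists_prim b' hb'
      rw [aw_smul_s5 _ _ _ hg]
      rcases hprim b z hz with hb | hb
      · exact h b hb
      · omega
  refine ⟨N0 + q * M + 1 + (F ×ˢ F).sup (fun p => NN p.1 p.2), fun n hn c hc => ?_⟩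
  rw [opt_iff _ _ hc, opt_iff _ _ hc]
  obtain ⟨c', y, hy, g, hg, rfl⟩ := exists_prim c hc
  rw [aw_smul_s5 _ _ _ hg, aw_smul_s5 _ _ _ hg, hopt n (by omega) c' y hy,
    hopt (n + D) (by omega) c' y hy]
  refine and_congr_right (fun hcF => forall₂_congr (fun b hb => ?_))
  refine hNN c' b hcF hb n ?_
  have := Finset.le_sup (f := fun p : (Fin d → ℤ) × (Fin d → ℤ) => NN p.1 p.2)
    (Finset.mk_mem_product hcF hb)
  simp only at this
  omega

lemma flat_case {d : ℕ} {P : Set (Fin d → ℝ)} (hP : Convex ℝ P)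
    {D : ℕ} (hD : 0 < D) {U : Finset (Fin d → ℤ)} (hU0 : U.Nonempty)
    (hU : (D : ℝ) • P = convexHull ℝ
      ((fun v : Fin d → ℤ => (fun i => ((v i : ℤ) : ℝ))) '' (U : Set (Fin d → ℤ))))
    (c0 : Fin d → ℤ) (hc0 : c0 ≠ 0) (t : ℝ) (ht : ∀ p ∈ P, ∑ i, (c0 i : ℝ) * p i = t) :
    ∃ N : ℕ, ∀ n, N ≤ n → ∀ c : Fin d → ℤ, c ≠ 0 →
      (aw c ((n : ℝ) • P) = awMin ((n : ℝ) • P) ↔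
        aw c (((n + D : ℕ) : ℝ) • P) = awMin (((n + D : ℕ) : ℝ) • P)) := by
  let L : ℕ → Submodule ℤ (Fin d → ℤ) := fun n => Submodule.span ℤ
    {w | ∃ x ∈ intPts ((n : ℝ) • P), ∃ y ∈ intPts ((n : ℝ) • P), w = x - y}
  have hmono : ∀ n, 0 ≤ n → L n ≤ L (n + D) := by
    intro n _
    apply Submodule.span_mono
    rintro _ ⟨x, hx, y, hy, rfl⟩
    obtain ⟨u, hu⟩ := hU0
    exact ⟨x + u, pts_add hP hU hx hu, y + u, pts_add hP hU hy hu, by abel⟩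
  obtain ⟨N, hN⟩ := stab L D 0 hD hmono
  have hle1 : ∀ (n : ℕ) (c : Fin d → ℤ), aw c ((n : ℝ) • P) ≤ 1 ↔
      ∀ w ∈ L n, ∑ i, c i * w i = 0 := by
    intro n c
    unfold aw
    rw [Set.ncard_le_one (AR_finite hD hU0 hU n c)]
    constructor
    · intro h w hw
      have hs : L n ≤ LinearMap.ker (dotProductBilin ℤ ℤ c) := by
        rw [Submodule.span_le]
        rintro _ ⟨x, hx, y, hy, rfl⟩
        show ∑ i, c i * (x - y) i = 0
        have := h _ ⟨x, hx, rfl⟩ _ ⟨y, hy, rfl⟩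
        simp only [Pi.sub_apply, mul_sub, Finset.sum_sub_distrib]
        omega
      exact hs hw
    · rintro h _ ⟨x, hx, rfl⟩ _ ⟨y, hy, rfl⟩
      have := h (x - y) (Submodule.subset_span ⟨x, hx, y, hy, rfl⟩)
      simp only [Pi.sub_apply, mul_sub, Finset.sum_sub_distrib] at this
      omega
  have h0 : ∀ n : ℕ, aw c0 ((n : ℝ) • P) ≤ 1 := by
    intro n
    unfold aw
    rw [Set.ncard_le_one (AR_finite hD hU0 hU n c0)]
    have hval : ∀ x ∈ intPts ((n : ℝ) • P), ((∑ i, c0 i * x i : ℤ) : ℝ) = n * t := by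
      intro x hx
      obtain ⟨p, hp, hpx⟩ := Set.mem_smul_set.1 (show (fun i => (x i : ℝ)) ∈ (n : ℝ) • P from hx)
      have h2 : ∀ i, (x i : ℝ) = n * p i := fun i => (congrFun hpx i).symm
      push_cast
      rw [← ht p hp, Finset.mul_sum]
      refine Finset.sum_congr rfl (fun i _ => ?_)
      rw [h2]; ring
    rintro _ ⟨x, hx, rfl⟩ _ ⟨y, hy, rfl⟩
    have := (hval x hx).trans (hval y hy).symm
    exact_mod_cast this
  have hopt : ∀ (n : ℕ) (c : Fin d → ℤ), c ≠ 0 →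
      (aw c ((n : ℝ) • P) = awMin ((n : ℝ) • P) ↔ aw c ((n : ℝ) • P) ≤ 1) := by
    intro n c hc
    rw [opt_iff _ _ hc]
    constructor
    · intro h; exact le_trans (h c0 hc0) (h0 n)
    · intro h b _
      rcases Set.eq_empty_or_nonempty (intPts ((n : ℝ) • P)) with he | ⟨x, hx⟩
      · have : AR c ((n : ℝ) • P) = ∅ := by
          ext z; simp [AR, he]
        unfold aw
        rw [this]; simp
      · refine le_trans h ?_
        exact (Set.ncard_pos (AR_finite hD hU0 hU n b)).2 ⟨_, x, hx, rfl⟩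
  refine ⟨N, fun n hn c hc => ?_⟩
  rw [hopt n c hc, hopt (n + D) c hc, hle1, hle1, hN n hn]

/-- for a rational polytope `P` with denominator `D`, and sufficiently
large dilation parameters `n₁ ≡ n₂ (mod D)`, the minimum arithmetic widths of `n₁P`
and `n₂P` are attained in exactly the same nonzero integer directions. -/
theorem optimal_directions_periodic {d : ℕ} (P : Set (Fin d → ℝ)) (hP : IsRatPolytope P)
    (D : ℕ) (hD : IsDenom P D) :
    ∃ N : ℕ, ∀ n₁ n₂ : ℕ, N ≤ n₁ → N ≤ n₂ → n₁ % D = n₂ % D →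
      ∀ c : Fin d → ℤ, c ≠ 0 →
        (aw c ((n₁ : ℝ) • P) = awMin ((n₁ : ℝ) • P) ↔
         aw c ((n₂ : ℝ) • P) = awMin ((n₂ : ℝ) • P)) := by
  have hconv := convex_of_rat hP
  obtain ⟨hD0, ⟨U, hU0, hU⟩, _⟩ := hD
  have hstep : ∃ N : ℕ, ∀ n, N ≤ n → ∀ c : Fin d → ℤ, c ≠ 0 →
      (aw c ((n : ℝ) • P) = awMin ((n : ℝ) • P) ↔
        aw c (((n + D : ℕ) : ℝ) • P) = awMin (((n + D : ℕ) : ℝ) • P)) := by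
    by_cases hint : (interior P).Nonempty
    · exact full_dim_case hconv hint hD0 hU0 hU
    · obtain ⟨c0, hc0, t, ht⟩ := flat_direction hP hint
      exact flat_case hconv hD0 hU0 hU c0 hc0 t ht
  obtain ⟨N, hN⟩ := hstep
  refine ⟨N, fun n₁ n₂ h1 h2 hm c hc => iff_of_eq ?_⟩
  exact periodic_of_step (fun n : ℕ => aw c ((n : ℝ) • P) = awMin ((n : ℝ) • P)) D N
    (fun n hn => propext (hN n hn c hc)) n₁ n₂ h1 h2 hm
end
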